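/- Let α ≥ 0 be a real number. For all integers n ≥ Ñ(α), one has L(n,α) < u_α(n) < U(n,α), where u_α(n) = r_α(n−1)·r_α(n+1)/r_α(n)², U(n,α) = 1 + 3π/(4n^{5/2}) + (3 + 3α − 2·log 8 − 2(1+α)·log n)/n³ − 15/(4π·n^{7/2}) − 3/(π²·n⁴) + 35(−16 + 3π⁴)/(192π³·n^{9/2}) + (6α + 2^{12} + 2^{31+18α} + (2 + 17α)·log n)/n⁵, and L(n,α) = 1 + 3π/(4n^{5/2}) + (3 + 3α − 2·log 8 − 2(1+α)·log n)/n³ − 15/(4π·n^{7/2}) − 3/(π²·n⁴) + 35(−16 + 3π⁴)/(192π³·n^{9/2}) − (258 + (80 + 2^{16+7α})·log n)/n⁵. -/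

import Mathlib

open Real

/-- The overpartition function. -/
noncomputable def pbar (n : ℕ) : ℕ :=
  ∑ k ∈ Finset.range (n + 1),
    (Nat.Partition.distincts k).card * Fintype.card (Nat.Partition (n - k))

/-- `r_α(n) = (p̄(n)/n^α)^(1/n)`. -/
noncomputable def rseq (α : ℝ) (n : ℕ) : ℝ :=
  ((pbar n : ℝ) / (n : ℝ) ^ α) ^ ((n : ℝ)⁻¹)

/-- `u_α(n) = r_α(n−1) r_α(n+1) / r_α(n)²`. -/
noncomputable def useq (α : ℝ) (n : ℕ) : ℝ :=
  rseq α (n - 1) * rseq α (n + 1) / (rseq α n) ^ 2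

noncomputable def Nt1 (α : ℝ) : ℝ :=
  max ((⌈Real.sqrt (2 * α)⌉ : ℤ) : ℝ)
    (max ((⌈(3 * α) ^ ((1 : ℝ) / 3)⌉ : ℤ) : ℝ)
      (max ((⌈(11 * α / 3) ^ ((1 : ℝ) / 4)⌉ : ℤ) : ℝ) ((⌈(10 * α) ^ ((1 : ℝ) / 5)⌉ : ℤ) : ℝ)))

noncomputable def Nt2 (α : ℝ) : ℝ :=
  max (2 : ℝ) (max ((⌈Real.sqrt (2 * α)⌉ : ℤ) : ℝ)
    (max ((⌈(3 * α) ^ ((1 : ℝ) / 3)⌉ : ℤ) : ℝ)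
      (max ((⌈(11 * α / 3) ^ ((1 : ℝ) / 4)⌉ : ℤ) : ℝ) ((⌈(12 * α) ^ ((1 : ℝ) / 5)⌉ : ℤ) : ℝ))))

noncomputable def Nt3 (α : ℝ) : ℝ :=
  max (5505 : ℝ) (max ((⌈(4 * α / (α ^ 2 + 1)) ^ ((4 : ℝ) / 3)⌉ : ℤ) : ℝ)
    ((⌈(4 * α) ^ ((4 : ℝ) / 11)⌉ : ℤ) : ℝ))

noncomputable def Ntil (α : ℝ) : ℝ := max (Nt1 α) (max (Nt2 α) (Nt3 α))

noncomputable def Ubound (n : ℕ) (α : ℝ) : ℝ :=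
  1 + 3 * π / (4 * (n : ℝ) ^ ((5 : ℝ) / 2))
    + (3 + 3 * α - 2 * Real.log 8 - 2 * (1 + α) * Real.log n) / (n : ℝ) ^ 3
    - 15 / (4 * π * (n : ℝ) ^ ((7 : ℝ) / 2)) - 3 / (π ^ 2 * (n : ℝ) ^ 4)
    + 35 * (-16 + 3 * π ^ 4) / (192 * π ^ 3 * (n : ℝ) ^ ((9 : ℝ) / 2))
    + (6 * α + 2 ^ 12 + (2 : ℝ) ^ (31 + 18 * α) + (2 + 17 * α) * Real.log n) / (n : ℝ) ^ 5

noncomputable def Lbound (n : ℕ) (α : ℝ) : ℝ :=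
  1 + 3 * π / (4 * (n : ℝ) ^ ((5 : ℝ) / 2))
    + (3 + 3 * α - 2 * Real.log 8 - 2 * (1 + α) * Real.log n) / (n : ℝ) ^ 3
    - 15 / (4 * π * (n : ℝ) ^ ((7 : ℝ) / 2)) - 3 / (π ^ 2 * (n : ℝ) ^ 4)
    + 35 * (-16 + 3 * π ^ 4) / (192 * π ^ 3 * (n : ℝ) ^ ((9 : ℝ) / 2))
    - (258 + (80 + (2 : ℝ) ^ (16 + 7 * α)) * Real.log n) / (n : ℝ) ^ 5

/-! ### The generating function of overpartitions -/

section GeneratingFunction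

open Finset PowerSeries
open scoped PowerSeries.WithPiTopology

/-- Formal power series in `x ^ k`: `∑ X ^ (k j)`. -/
noncomputable def geomSeries (k : ℕ) : ℝ⟦X⟧ := ∑' j : ℕ, (X : ℝ⟦X⟧) ^ (k * j)

lemma geomSeries_mul (i : ℕ) : geomSeries (i + 1) * (1 - X ^ (i + 1)) = 1 := by
  unfold geomSeries
  simp_rw [pow_mul]
  exact WithPiTopology.tsum_pow_mul_one_sub_of_constantCoeff_eq_zero (by simp)

lemma geomSeries_eq_mk (i : ℕ) :
    geomSeries (i + 1) = PowerSeries.mk fun n ↦ if (i + 1) ∣ n then (1 : ℝ) else 0 := by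
  have h : (PowerSeries.mk fun n ↦ if (i + 1) ∣ n then (1 : ℝ) else 0) *
      (1 - X ^ (i + 1)) = 1 := by
    ext n
    rw [mul_sub, mul_one, map_sub, coeff_mul_X_pow', coeff_mk, coeff_one]
    by_cases hn : i + 1 ≤ n
    · have : (i + 1) ∣ n ↔ (i + 1) ∣ (n - (i + 1)) := by
        exact ⟨fun h ↦ Nat.dvd_sub h dvd_rfl, fun h ↦ by
          simpa [Nat.sub_add_cancel hn] using Nat.dvd_add h (dvd_refl (i + 1))⟩
      rw [if_pos hn, if_neg (show n ≠ 0 by omega), if_congr this rfl rfl, coeff_mk, sub_self]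
    · by_cases h0 : n = 0
      · simp [h0]
      · have : ¬ (i + 1) ∣ n := fun h ↦ hn (Nat.le_of_dvd (by omega) h)
        rw [if_neg hn, if_neg h0, if_neg this, sub_self]
  have h' := geomSeries_mul i
  calc geomSeries (i + 1) = geomSeries (i + 1) * ((PowerSeries.mk fun n ↦
        if (i + 1) ∣ n then (1 : ℝ) else 0) * (1 - X ^ (i + 1))) := by rw [h, mul_one]
    _ = (PowerSeries.mk fun n ↦ if (i + 1) ∣ n then (1 : ℝ) else 0) *
        (geomSeries (i + 1) * (1 - X ^ (i + 1))) := by ring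
    _ = _ := by rw [h', mul_one]

/-- Absolute convergence of a real power series at a complex point. -/
def AbsConv (F : ℝ⟦X⟧) (q : ℂ) : Prop :=
  Summable fun n ↦ ‖((coeff n F : ℝ) : ℂ) * q ^ n‖

/-- The value of a real power series at a complex point. -/
noncomputable def evalAt (F : ℝ⟦X⟧) (q : ℂ) : ℂ := ∑' n, ((coeff n F : ℝ) : ℂ) * q ^ n

lemma mul_term (F G : ℝ⟦X⟧) (q : ℂ) (n : ℕ) :
    ∑ kl ∈ antidiagonal n, (((coeff kl.1 F : ℝ) : ℂ) * q ^ kl.1) * (((coeff kl.2 G : ℝ) : ℂ) *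
        q ^ kl.2)
      = ((coeff n (F * G) : ℝ) : ℂ) * q ^ n := by
  rw [coeff_mul]
  push_cast
  rw [Finset.sum_mul]
  refine Finset.sum_congr rfl fun kl h ↦ ?_
  rw [← mem_antidiagonal.mp h]
  ring

lemma AbsConv.mul {F G : ℝ⟦X⟧} {q : ℂ} (hF : AbsConv F q) (hG : AbsConv G q) :
    AbsConv (F * G) q := by
  have := summable_norm_sum_mul_antidiagonal_of_summable_norm hF hG
  simp_rw [mul_term] at this
  exact this

lemma evalAt_mul {F G : ℝ⟦X⟧} {q : ℂ} (hF : AbsConv F q) (hG : AbsConv G q) :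
    evalAt (F * G) q = evalAt F q * evalAt G q := by
  have := tsum_mul_tsum_eq_tsum_sum_antidiagonal_of_summable_norm hF hG
  simp_rw [mul_term] at this
  exact this.symm

lemma absConv_one (q : ℂ) : AbsConv 1 q := by
  refine summable_of_ne_finset_zero (s := {0}) fun n hn ↦ ?_
  simp [coeff_one, Finset.mem_singleton.not.mp hn]

lemma evalAt_one (q : ℂ) : evalAt 1 q = 1 := by
  unfold evalAt
  rw [tsum_eq_single 0 (fun n hn ↦ by simp [coeff_one, hn])]
  simp

lemma absConv_prod {F : ℕ → ℝ⟦X⟧} {q : ℂ} (hF : ∀ i, AbsConv (F i) q) (s : Finset ℕ) :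
    AbsConv (∏ i ∈ s, F i) q ∧ evalAt (∏ i ∈ s, F i) q = ∏ i ∈ s, evalAt (F i) q := by
  classical
  induction s using Finset.induction_on with
  | empty => simpa using ⟨absConv_one q, evalAt_one q⟩
  | insert a s ha ih =>
    rw [prod_insert ha, prod_insert ha]
    exact ⟨(hF a).mul ih.1, by rw [evalAt_mul (hF a) ih.1, ih.2]⟩

/-- If the partial products of power series with nonnegative coefficients and constant coefficient
`1` converge formally, and the values at `q` and `‖q‖` form multipliable families, then the formal
product converges absolutely at `q`, to the product of the values. -/
lemma hasProd_evalAt {F : ℕ → ℝ⟦X⟧} {G : ℝ⟦X⟧} (hFG : HasProd F G)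
    (hnn : ∀ i n, 0 ≤ coeff n (F i)) (h1 : ∀ i, coeff 0 (F i) = 1) {q : ℂ}
    (hF : ∀ i, AbsConv (F i) q) (hm : Multipliable fun i ↦ evalAt (F i) (‖q‖ : ℂ)) :
    AbsConv G q ∧ HasProd (fun i ↦ evalAt (F i) q) (evalAt G q) := by
  classical
  have hcoeff : ∀ n, Filter.Tendsto (fun s : Finset ℕ ↦ coeff n (∏ i ∈ s, F i)) Filter.atTop
      (nhds (coeff n G)) := by
    have := hFG
    rw [HasProd, WithPiTopology.tendsto_iff_coeff_tendsto] at this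
    exact this
  have hnn' : ∀ (s : Finset ℕ) n, 0 ≤ coeff n (∏ i ∈ s, F i) := by
    intro s
    induction s using Finset.induction_on with
    | empty => intro n; simp only [prod_empty, coeff_one]; split_ifs <;> norm_num
    | insert a s ha ih =>
      intro n
      rw [prod_insert ha, coeff_mul]
      exact sum_nonneg fun kl _ ↦ mul_nonneg (hnn _ _) (ih _)
  have hmono : ∀ n, Monotone fun s : Finset ℕ ↦ coeff n (∏ i ∈ s, F i) := by
    intro n
    refine Finset.monotone_iff_forall_le_insert.mpr fun s a ha ↦ ?_
    rw [prod_insert ha, coeff_mul]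
    have := single_le_sum (f := fun kl : ℕ × ℕ ↦ coeff kl.1 (F a) * coeff kl.2 (∏ i ∈ s, F i))
      (s := antidiagonal n) (fun kl _ ↦ mul_nonneg (hnn _ _) (hnn' s _))
      (show (0, n) ∈ antidiagonal n by simp)
    simpa [h1] using this
  have hle : ∀ s n, coeff n (∏ i ∈ s, F i) ≤ coeff n G := fun s n ↦
    (hmono n).ge_of_tendsto (hcoeff n) s
  have hGnn : ∀ n, 0 ≤ coeff n G := fun n ↦ (hnn' ∅ n).trans (hle ∅ n)
  have hF' : ∀ i, AbsConv (F i) (‖q‖ : ℂ) := fun i ↦ by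
    simpa [AbsConv] using hF i
  have hre : ∀ s : Finset ℕ, ∑' n, coeff n (∏ i ∈ s, F i) * ‖q‖ ^ n =
      (∏ i ∈ s, evalAt (F i) (‖q‖ : ℂ)).re := by
    intro s
    rw [← (absConv_prod hF' s).2, evalAt, ← Complex.ofReal_re (∑' n, _)]
    push_cast
    rfl
  have hsumm : ∀ s : Finset ℕ, Summable fun n ↦ coeff n (∏ i ∈ s, F i) * ‖q‖ ^ n := by
    intro s
    have := (absConv_prod hF' s).1
    simpa [AbsConv, abs_of_nonneg (hnn' s _)] using this
  have hG : Summable fun n ↦ coeff n G * ‖q‖ ^ n := by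
    have hlim := (Complex.continuous_re.tendsto _).comp hm.hasProd
    refine summable_of_sum_range_le (c := (∏' i, evalAt (F i) (‖q‖ : ℂ)).re)
      (fun n ↦ mul_nonneg (hGnn n) (by positivity)) fun N ↦ ?_
    have hl : Filter.Tendsto (fun s : Finset ℕ ↦ ∑ n ∈ range N, coeff n (∏ i ∈ s, F i) * ‖q‖ ^ n)
        Filter.atTop (nhds (∑ n ∈ range N, coeff n G * ‖q‖ ^ n)) :=
      tendsto_finsetSum _ fun n _ ↦ (hcoeff n).mul_const _
    refine le_of_tendsto_of_tendsto' hl hlim fun s ↦ ?_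
    have := (hsumm s).sum_le_tsum (range N) fun n _ ↦ mul_nonneg (hnn' s n) (by positivity)
    rw [hre s] at this
    simpa using this
  refine ⟨by simpa [AbsConv, abs_of_nonneg (hGnn _)] using hG, ?_⟩
  have key := tendsto_tsum_of_dominated_convergence (𝓕 := (Filter.atTop : Filter (Finset ℕ)))
    (f := fun s n ↦ ((coeff n (∏ i ∈ s, F i) : ℝ) : ℂ) * q ^ n)
    (g := fun n ↦ ((coeff n G : ℝ) : ℂ) * q ^ n) hG
    (fun n ↦ ((Complex.continuous_ofReal.tendsto _).comp (hcoeff n)).mul_const _)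
    (Filter.Eventually.of_forall fun s n ↦ by
      simp only [norm_mul, norm_pow, Complex.norm_real, Real.norm_eq_abs, abs_of_nonneg (hnn' s n)]
      exact mul_le_mul_of_nonneg_right (hle s n) (by positivity))
  refine key.congr fun s ↦ ?_
  exact (absConv_prod hF s).2

lemma absConv_of_le {F : ℝ⟦X⟧} {q : ℂ} (hq : ‖q‖ < 1) (hF : ∀ n, |coeff n F| ≤ 1) :
    AbsConv F q := by
  refine Summable.of_nonneg_of_le (fun n ↦ norm_nonneg _) (fun n ↦ ?_)
    (summable_geometric_of_lt_one (norm_nonneg q) hq)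
  rw [norm_mul, norm_pow, Complex.norm_real, Real.norm_eq_abs]
  exact mul_le_of_le_one_left (by positivity) (hF n)

lemma absConv_X_pow (k : ℕ) (q : ℂ) : AbsConv (X ^ k) q := by
  refine summable_of_ne_finset_zero (s := {k}) fun n hn ↦ ?_
  simp [coeff_X_pow, Finset.mem_singleton.not.mp hn]

lemma evalAt_X_pow (k : ℕ) (q : ℂ) : evalAt (X ^ k) q = q ^ k := by
  unfold evalAt
  rw [tsum_eq_single k (fun n hn ↦ by simp [coeff_X_pow, hn])]
  simp [coeff_X_pow]

lemma evalAt_geomSeries (i : ℕ) {q : ℂ} (hq : ‖q‖ < 1) :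
    AbsConv (geomSeries (i + 1)) q ∧ evalAt (geomSeries (i + 1)) q = (1 - q ^ (i + 1))⁻¹ := by
  have h1 : AbsConv (geomSeries (i + 1)) q := by
    refine absConv_of_le hq fun n ↦ ?_
    rw [geomSeries_eq_mk, coeff_mk]
    split_ifs <;> simp
  refine ⟨h1, ?_⟩
  refine eq_inv_of_mul_eq_one_left ?_
  have h2 : AbsConv (1 - X ^ (i + 1)) q := by
    refine absConv_of_le hq fun n ↦ ?_
    rw [map_sub, coeff_one, coeff_X_pow]
    split_ifs <;> simp
  have h3 : evalAt (1 - X ^ (i + 1)) q = 1 - q ^ (i + 1) := by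
    rw [← evalAt_one q, ← evalAt_X_pow (i + 1) q]
    unfold evalAt
    rw [← ((absConv_one q).of_norm).tsum_sub ((absConv_X_pow _ q).of_norm)]
    refine tsum_congr fun n ↦ ?_
    rw [map_sub]
    push_cast
    ring
  rw [← h3, ← evalAt_mul h1 h2, geomSeries_mul, evalAt_one]

lemma evalAt_one_add (i : ℕ) (q : ℂ) :
    AbsConv (1 + X ^ (i + 1)) q ∧ evalAt (1 + X ^ (i + 1)) q = 1 + q ^ (i + 1) := by
  have h : ∀ n, ((coeff n (1 + X ^ (i + 1) : ℝ⟦X⟧) : ℝ) : ℂ) * q ^ n =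
      ((coeff n (1 : ℝ⟦X⟧) : ℝ) : ℂ) * q ^ n + ((coeff n (X ^ (i +
          1) : ℝ⟦X⟧) : ℝ) : ℂ) * q ^ n := by
    intro n
    rw [map_add]
    push_cast
    ring
  constructor
  · refine Summable.of_nonneg_of_le (fun n ↦ norm_nonneg _) (fun n ↦ ?_)
      ((absConv_one q).add (absConv_X_pow (i + 1) q))
    rw [h]
    exact norm_add_le _ _
  · rw [← evalAt_one q, ← evalAt_X_pow (i + 1) q]
    unfold evalAt
    rw [← ((absConv_one q).of_norm).tsum_add ((absConv_X_pow _ q).of_norm)]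
    exact tsum_congr h

lemma hasProd_pbar_series :
    HasProd (fun i : ℕ ↦ (1 + X ^ (i + 1)) * geomSeries (i + 1))
      (PowerSeries.mk fun n ↦ (pbar n : ℝ)) := by
  have h1 := Nat.Partition.hasProd_powerSeriesMk_card_countRestricted ℝ (m := 2) (by norm_num)
  have h2 := Nat.Partition.hasProd_powerSeriesMk_card_restricted ℝ (fun _ ↦ True)
  have h3 := h1.mul h2
  convert! h3 using 1
  · ext1 i
    simp [Finset.sum_range_succ, geomSeries]
  · ext n
    rw [coeff_mul, coeff_mk, pbar, Finset.Nat.sum_antidiagonal_eq_sum_range_succ_mk]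
    simp [Nat.Partition.countRestricted_two, Nat.Partition.restricted, Finset.card_univ]

lemma multipliable_one_add_pow {q : ℂ} (hq : ‖q‖ < 1) :
    Multipliable fun n : ℕ ↦ 1 + q ^ (n + 1) := by
  apply multipliable_one_add_of_summable
  simpa using (summable_nat_add_iff 1).mpr (summable_geometric_of_lt_one (norm_nonneg _) hq)

/-- Euler's function `∏ (1 - q ^ n)`. -/
noncomputable def eulerPhi (q : ℂ) : ℂ := ∏' n : ℕ, (1 - q ^ (n + 1))

lemma one_sub_pow_succ_ne_zero {q : ℂ} (hq : ‖q‖ < 1) (n : ℕ) : 1 - q ^ (n + 1) ≠ 0 := by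
  intro h
  have h1 : ‖q ^ (n + 1)‖ = 1 := by rw [← sub_eq_zero.mp h, norm_one]
  rw [norm_pow] at h1
  exact absurd h1 (pow_lt_one₀ (norm_nonneg _) hq (by omega)).ne

lemma eulerPhi_ne_zero {q : ℂ} (hq : ‖q‖ < 1) : eulerPhi q ≠ 0 := by
  refine tprod_one_add_ne_zero_of_summable (f := fun n ↦ -q ^ (n + 1)) ?_ ?_
  · intro i
    simpa [sub_eq_add_neg] using one_sub_pow_succ_ne_zero hq i
  · simpa using (summable_nat_add_iff 1).mpr (summable_geometric_of_lt_one (norm_nonneg _) hq)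

lemma hasProd_pbar {q : ℂ} (hq : ‖q‖ < 1) :
    (Summable fun n ↦ (pbar n : ℝ) * ‖q‖ ^ n) ∧
    HasProd (fun i : ℕ ↦ (1 + q ^ (i + 1)) / (1 - q ^ (i + 1))) (∑' n, (pbar n : ℂ) * q ^ n) := by
  have hconv : ∀ {q : ℂ}, ‖q‖ < 1 → ∀ i : ℕ, AbsConv ((1 + X ^ (i + 1)) * geomSeries (i + 1)) q ∧
      evalAt ((1 + X ^ (i + 1)) * geomSeries (i + 1)) q =
        (1 + q ^ (i + 1)) / (1 - q ^ (i + 1)) := by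
    intro q hq i
    have h1 := evalAt_one_add i q
    have h2 := evalAt_geomSeries i hq
    refine ⟨h1.1.mul h2.1, ?_⟩
    rw [evalAt_mul h1.1 h2.1, h1.2, h2.2, div_eq_mul_inv]
  have hq' : ‖(‖q‖ : ℂ)‖ < 1 := by simpa using hq
  have hmain := hasProd_evalAt hasProd_pbar_series (q := q) ?_ ?_ (fun i ↦ (hconv hq i).1) ?_
  · refine ⟨?_, ?_⟩
    · simpa [AbsConv] using hmain.1
    · have h := hmain.2
      simp_rw [(hconv hq _).2] at h
      simpa [evalAt] using h
  · intro i n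
    rw [add_mul, one_mul, map_add, geomSeries_eq_mk, coeff_X_pow_mul']
    simp only [coeff_mk]
    split_ifs <;> norm_num
  · intro i
    rw [add_mul, one_mul, map_add, geomSeries_eq_mk, coeff_X_pow_mul']
    simp
  · simp_rw [(hconv hq' _).2]
    exact ((multipliable_one_add_pow hq').hasProd.div₀
      (ModularForm.multipliable_one_sub_pow hq').hasProd (eulerPhi_ne_zero hq')).multipliable

end GeneratingFunction

/-- The generating function of the overpartition function. -/
noncomputable def pbarGen (q : ℂ) : ℂ := ∑' n, (pbar n : ℂ) * q ^ n

lemma pbarGen_eq {q : ℂ} (hq : ‖q‖ < 1) : pbarGen q = eulerPhi (q ^ 2) / eulerPhi q ^ 2 := by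
  have hq2 : ‖q ^ 2‖ < 1 := by
    rw [norm_pow]
    exact pow_lt_one₀ (norm_nonneg _) hq two_ne_zero
  have h1 := (ModularForm.multipliable_one_sub_pow hq).hasProd
  have h2 := (ModularForm.multipliable_one_sub_pow hq2).hasProd
  have h3 := h2.div₀ (h1.mul h1) (mul_ne_zero (eulerPhi_ne_zero hq) (eulerPhi_ne_zero hq))
  rw [eulerPhi, eulerPhi, sq (∏' n : ℕ, (1 - q ^ (n + 1)))]
  refine (hasProd_pbar hq).2.unique (?_)
  convert! h3 using 2 with i
  have := one_sub_pow_succ_ne_zero hq i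
  field_simp
  ring

/-! ### The modular transformation -/

/-- Value of `eta` at `I z / (2π)` in terms of Euler's function at `exp (-z)`. -/
lemma eta_eq_eulerPhi (z : ℂ) :
    ModularForm.eta (Complex.I * z / (2 * π)) =
      Complex.exp (-z / 24) * eulerPhi (Complex.exp (-z)) := by
  have hpi : (π : ℂ) ≠ 0 := Complex.ofReal_ne_zero.mpr pi_ne_zero
  have h1 : Function.Periodic.qParam 24 (Complex.I * z / (2 * π)) = Complex.exp (-z / 24) := by
    rw [Function.Periodic.qParam]
    congr 1
    push_cast
    field_simp
    linear_combination z * Complex.I_sq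
  have h2 : Complex.exp (2 * π * Complex.I * (Complex.I * z / (2 * π))) = Complex.exp (-z) := by
    congr 1
    field_simp
    linear_combination z * Complex.I_sq
  simp only [ModularForm.eta, h1, eulerPhi, ModularForm.eta_q_eq_pow, h2]

lemma eulerPhi_transform {z : ℂ} (hz : 0 < z.re) :
    Complex.exp (-(4 * π ^ 2 / z) / 24) * eulerPhi (Complex.exp (-(4 * π ^ 2 / z))) =
      (Complex.sqrt Complex.I)⁻¹ * Complex.sqrt (Complex.I * z / (2 * π)) *
        (Complex.exp (-z / 24) * eulerPhi (Complex.exp (-z))) := by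
  have hz0 : z ≠ 0 := by
    rintro rfl
    simp at hz
  have him : Complex.I * z / (2 * π) ∈ UpperHalfPlane.upperHalfPlaneSet := by
    have : (Complex.I * z / (2 * π)).im = z.re / (2 * π) := by
      rw [show (2 * π : ℂ) = ((2 * π : ℝ) : ℂ) by push_cast; rfl, Complex.div_ofReal_im]
      simp
    change 0 < (Complex.I * z / (2 * π)).im
    rw [this]
    positivity
  have h := ModularForm.eta_comp_eq_csqrt_I_inv him
  simp only [Function.comp_apply, Pi.smul_apply, Pi.mul_apply, smul_eq_mul] at h
  rw [eta_eq_eulerPhi, ← mul_assoc] at h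
  rw [← h, ← eta_eq_eulerPhi]
  congr 1
  field_simp
  linear_combination (4 : ℂ) * Complex.I_sq

lemma sqrt_I_mul {z : ℂ} (hz : 0 < z.re) :
    Complex.sqrt (Complex.I * z) = Complex.sqrt Complex.I * Complex.sqrt z := by
  have hz0 : z ≠ 0 := by
    rintro rfl
    simp at hz
  have harg := abs_lt.mp (Complex.abs_arg_lt_pi_div_two_iff.mpr (Or.inl hz))
  rw [sqrt_eq_exp (mul_ne_zero Complex.I_ne_zero hz0), sqrt_eq_exp hz0,
    sqrt_eq_exp Complex.I_ne_zero, ← Complex.exp_add,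
    Complex.log_mul Complex.I_ne_zero hz0]
  · congr 1
    ring
  · rw [Complex.arg_I]
    constructor <;> linarith [pi_pos]

lemma complex_sqrt_sq (z : ℂ) : Complex.sqrt z ^ 2 = z := by
  rw [Complex.sqrt]
  exact Complex.cpow_ofNat_inv_pow z 2

/-- The correction factor in the transformation formula of `pbarGen`. -/
noncomputable def modRatio (x : ℂ) : ℂ := eulerPhi x / eulerPhi (x ^ 2) ^ 2

lemma norm_exp_neg_lt_one {z : ℂ} (hz : 0 < z.re) : ‖Complex.exp (-z)‖ < 1 := by
  rw [Complex.norm_exp]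
  simpa using hz

lemma re_div_pos {z : ℂ} (hz : 0 < z.re) {c : ℝ} (hc : 0 < c) : 0 < ((c : ℂ) / z).re := by
  have hz0 : z ≠ 0 := by
    rintro rfl
    simp at hz
  rw [Complex.div_re]
  have := Complex.normSq_pos.mpr hz0
  simp only [Complex.ofReal_re, Complex.ofReal_im, zero_mul, zero_div, add_zero]
  positivity

lemma pbarGen_exp_neg {z : ℂ} (hz : 0 < z.re) :
    pbarGen (Complex.exp (-z)) = 1 / 2 * Complex.sqrt (z / π) * Complex.exp (π ^ 2 / (4 * z)) *
      modRatio (Complex.exp (-(2 * π ^ 2 / z))) := by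
  have hpi : (π : ℂ) ≠ 0 := Complex.ofReal_ne_zero.mpr pi_ne_zero
  have hz0 : z ≠ 0 := by
    rintro rfl
    simp at hz
  have hz2 : 0 < (2 * z).re := by simpa using hz
  have hzpi : 0 < (z / π).re := by
    rw [Complex.div_ofReal_re]
    positivity
  have hx : 0 < (2 * (π : ℂ) ^ 2 / z).re := by
    have := re_div_pos hz (show (0 : ℝ) < 2 * π ^ 2 by positivity)
    push_cast at this
    exact this
  have hqlt := norm_exp_neg_lt_one hz
  have hxlt := norm_exp_neg_lt_one hx
  have hxlt2 : ‖Complex.exp (-(2 * (π : ℂ) ^ 2 / z)) ^ 2‖ < 1 := by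
    rw [norm_pow]
    exact pow_lt_one₀ (norm_nonneg _) hxlt two_ne_zero
  rw [pbarGen_eq hqlt, modRatio]
  have e1 : Complex.exp (-z) ^ 2 = Complex.exp (-(2 * z)) := by
    rw [← Complex.exp_nat_mul]
    congr 1
    push_cast
    ring
  have e2 : Complex.exp (-(2 * (π : ℂ) ^ 2 / z)) ^ 2 = Complex.exp (-(4 * π ^ 2 / z)) := by
    rw [← Complex.exp_nat_mul]
    congr 1
    push_cast
    ring
  have t1 := eulerPhi_transform hz
  have t2 := eulerPhi_transform hz2
  rw [show 4 * (π : ℂ) ^ 2 / (2 * z) = 2 * π ^ 2 / z by field_simp; norm_num,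
    show Complex.I * (2 * z) / (2 * π) = Complex.I * (z / π) by field_simp,
    sqrt_I_mul hzpi] at t2
  rw [e2] at hxlt2
  rw [e1, e2]
  have n1 := eulerPhi_ne_zero hqlt
  have n4 := eulerPhi_ne_zero hxlt2
  set A := eulerPhi (Complex.exp (-z))
  set B := eulerPhi (Complex.exp (-(2 * z)))
  set C := eulerPhi (Complex.exp (-(2 * (π : ℂ) ^ 2 / z)))
  set D := eulerPhi (Complex.exp (-(4 * (π : ℂ) ^ 2 / z)))
  have hsI : Complex.sqrt Complex.I ≠ 0 := fun h ↦ by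
    have := complex_sqrt_sq Complex.I
    rw [h, zero_pow two_ne_zero] at this
    exact Complex.I_ne_zero this.symm
  have t1' : Complex.exp (-(4 * π ^ 2 / z) / 24) ^ 2 * D ^ 2 =
      z / (2 * π) * (Complex.exp (-z / 24) ^ 2 * A ^ 2) := by
    have h1 := complex_sqrt_sq (Complex.I * z / (2 * π))
    have h2 := complex_sqrt_sq Complex.I
    rw [← mul_pow, t1, mul_pow, mul_pow, h1, inv_pow, h2, mul_pow]
    field_simp
  have t2' : Complex.exp (-(2 * π ^ 2 / z) / 24) * C = Complex.sqrt (z / π) *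
      (Complex.exp (-(2 * z) / 24) * B) := by
    rw [t2]
    field_simp
  have e3 : Complex.exp (-z / 24) ^ 2 = Complex.exp (-(2 * z) / 24) := by
    rw [← Complex.exp_nat_mul]
    congr 1
    push_cast
    ring
  have e4 : Complex.exp (-(4 * π ^ 2 / z) / 24) ^ 2 * Complex.exp (π ^ 2 / (4 * z)) =
      Complex.exp (-(2 * π ^ 2 / z) / 24) := by
    rw [← Complex.exp_nat_mul, ← Complex.exp_add]
    congr 1
    push_cast
    field_simp
    ring
  have hs := complex_sqrt_sq (z / π)
  rw [e3] at t1'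
  have hE : Complex.exp (-(2 * z) / 24) ≠ 0 := Complex.exp_ne_zero _
  set E := Complex.exp (-(2 * z) / 24)
  set F := Complex.exp (-(2 * π ^ 2 / z) / 24)
  set K := Complex.exp (-(4 * π ^ 2 / z) / 24) ^ 2
  set S := Complex.sqrt (z / π)
  set T := Complex.exp (π ^ 2 / (4 * z))
  rw [div_eq_iff (pow_ne_zero 2 n1)]
  have hzS : z / (2 * π) = S ^ 2 / 2 := by rw [hs]; field_simp
  rw [hzS] at t1'
  have hS : S ≠ 0 := fun h ↦ by
    rw [h] at hs
    have : z / π ≠ 0 := div_ne_zero hz0 hpi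
    exact this (by rw [← hs]; simp)
  refine mul_left_cancel₀ (mul_ne_zero hE hS) ?_
  calc E * S * B = F * C := by rw [t2']; ring
    _ = K * D ^ 2 * T * C / D ^ 2 := by rw [← e4]; field_simp
    _ = _ := by rw [t1']; field_simp

lemma norm_eulerPhi_sub_one_le {x : ℂ} (hx : ‖x‖ ≤ 1 / 100) : ‖eulerPhi x - 1‖ ≤ 11 / 10 * ‖x‖ := by
  have hlt : ‖x‖ < 1 := by linarith
  have hgeom : HasSum (fun n : ℕ ↦ ‖x‖ ^ (n + 1)) (‖x‖ * (1 - ‖x‖)⁻¹) := by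
    simpa [pow_succ'] using (hasSum_geometric_of_lt_one (norm_nonneg x) hlt).mul_left ‖x‖
  have hb : ∀ s : Finset ℕ, ‖∏ i ∈ s, (1 - x ^ (i + 1)) - 1‖ ≤ 11 / 10 * ‖x‖ := by
    intro s
    have h1 := Finset.norm_prod_one_add_sub_one_le s (fun i ↦ -x ^ (i + 1))
    simp only [← sub_eq_add_neg, norm_neg, norm_pow] at h1
    have h2 : ∑ i ∈ s, ‖x‖ ^ (i + 1) ≤ ‖x‖ * (1 - ‖x‖)⁻¹ :=
      sum_le_hasSum s (fun _ _ ↦ by positivity) hgeom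
    have h3 : ‖x‖ * (1 - ‖x‖)⁻¹ ≤ 102 / 100 * ‖x‖ := by
      rw [← div_eq_mul_inv, div_le_iff₀ (by linarith)]
      nlinarith [norm_nonneg x]
    set y := ∑ i ∈ s, ‖x‖ ^ (i + 1)
    have hy0 : 0 ≤ y := Finset.sum_nonneg fun _ _ ↦ by positivity
    have h4 := Real.abs_exp_sub_one_sub_id_le (x := y) (by rw [abs_of_nonneg hy0]; linarith)
    have h5 := (abs_le.mp h4).2
    nlinarith [norm_nonneg x]
  have hp := (ModularForm.multipliable_one_sub_pow hlt).hasProd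
  exact le_of_tendsto (((hp : Filter.Tendsto _ _ _).sub_const 1).norm)
    (Filter.Eventually.of_forall hb)

lemma norm_modRatio_sub_one_le {x : ℂ} (hx : ‖x‖ ≤ 1 / 100) : ‖modRatio x - 1‖ ≤ 2 * ‖x‖ := by
  have hx2 : ‖x ^ 2‖ ≤ 1 / 100 * ‖x‖ := by
    rw [norm_pow, sq]
    exact mul_le_mul_of_nonneg_right hx (norm_nonneg _)
  have h1 := norm_eulerPhi_sub_one_le hx
  have h2 := norm_eulerPhi_sub_one_le (x := x ^ 2) (by linarith [norm_nonneg x])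
  have hne : eulerPhi (x ^ 2) ≠ 0 := eulerPhi_ne_zero (by linarith [norm_nonneg x])
  rw [modRatio]
  set A := eulerPhi x
  set B := eulerPhi (x ^ 2)
  have hB : 98 / 100 ≤ ‖B‖ := by
    have := norm_sub_norm_le 1 (1 - B)
    rw [norm_one, sub_sub_cancel, norm_sub_rev] at this
    linarith [norm_nonneg x]
  have hB' : ‖B + 1‖ ≤ 21 / 10 := by
    have : B + 1 = (B - 1) + 2 := by ring
    rw [this]
    refine (norm_add_le _ _).trans ?_
    rw [Complex.norm_ofNat]
    linarith [norm_nonneg x]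
  rw [div_sub_one (pow_ne_zero 2 hne), norm_div, norm_pow, div_le_iff₀ (by positivity)]
  have h3 : ‖A - B ^ 2‖ ≤ 11 / 10 * ‖x‖ + 21 / 10 * (11 / 10 * (1 / 100 * ‖x‖)) := by
    have : A - B ^ 2 = (A - 1) - (B + 1) * (B - 1) := by ring
    rw [this]
    refine (norm_sub_le _ _).trans ?_
    rw [norm_mul]
    have : ‖B + 1‖ * ‖B - 1‖ ≤ 21 / 10 * (11 / 10 * (1 / 100 * ‖x‖)) :=
      mul_le_mul hB' (by linarith) (norm_nonneg _) (by norm_num)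
    linarith
  have : (98 / 100 : ℝ) ^ 2 ≤ ‖B‖ ^ 2 := pow_le_pow_left₀ (by norm_num) hB 2
  nlinarith [norm_nonneg x]

/-! ### Bounds away from the positive real axis -/

lemma norm_one_add_div_one_sub_le {w : ℂ} (hw : ‖w‖ < 1) :
    ‖(1 + w) / (1 - w)‖ ≤ (1 + ‖w‖) / (1 - ‖w‖) * Real.exp (-(2 * (‖w‖ - w.re))) := by
  have hw' : |‖w‖| < 1 := by rwa [abs_norm]
  have hn := Real.hasSum_log_sub_log_of_abs_lt_one hw'
  have hsum : ∀ {u : ℂ}, ‖u‖ < 1 →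
      HasSum (fun n : ℕ ↦ ((2 : ℂ) * (1 / (2 * n + 1)) * u ^ (2 * n + 1)))
        (Complex.log (1 + u) - Complex.log (1 - u)) := by
    intro u hu
    have h1 := Complex.hasSum_taylorSeries_log hu
    have h2 := Complex.hasSum_taylorSeries_neg_log hu
    have h3 := h1.add h2
    rw [← sub_eq_add_neg] at h3
    have hinj : Function.Injective (fun n : ℕ ↦ 2 * n + 1) := fun a b h ↦ by
      simpa using h
    rw [← hinj.hasSum_iff] at h3
    · convert! h3 using 1
      funext n
      simp only [Function.comp_apply, show 2 * n + 1 + 1 = 2 * (n + 1) by ring, pow_mul]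
      push_cast
      ring
    · intro m hm
      have hev : Even m := by
        by_contra h
        obtain ⟨k, hk⟩ := Nat.not_even_iff_odd.mp h
        exact hm ⟨k, hk.symm⟩
      rw [pow_succ, hev.neg_one_pow]
      ring
  have h1 : 1 + w ≠ 0 := fun h ↦ by
    have : w = -1 := by linear_combination h
    rw [this] at hw
    simp at hw
  have h2 : 1 - w ≠ 0 := fun h ↦ by
    have : w = 1 := by linear_combination -h
    rw [this] at hw
    simp at hw
  have hre := Complex.hasSum_re (hsum hw)
  have hexp : ‖(1 + w) / (1 - w)‖ = Real.exp (Complex.log (1 + w) - Complex.log (1 - w)).re := by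
    rw [← Complex.norm_exp, Complex.exp_sub, Complex.exp_log h1, Complex.exp_log h2]
  have hexp' : (1 + ‖w‖) / (1 - ‖w‖) = Real.exp (Real.log (1 + ‖w‖) - Real.log (1 - ‖w‖)) := by
    rw [Real.exp_sub, Real.exp_log (by positivity), Real.exp_log (by linarith)]
  rw [hexp, hexp', ← Real.exp_add]
  refine Real.exp_le_exp.mpr ?_
  have hd := hn.sub hre
  have := sum_le_hasSum {0} (fun n _ ↦ ?_) hd
  · simp at this
    rw [Complex.sub_re]
    linarith
  · have hle : (w ^ (2 * n + 1)).re ≤ ‖w‖ ^ (2 * n + 1) := by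
      rw [← norm_pow]
      exact Complex.re_le_norm _
    have hcast : (2 : ℂ) * (1 / (2 * n + 1)) * w ^ (2 * n + 1) =
        ((2 * (1 / (2 * n + 1)) : ℝ) : ℂ) * w ^ (2 * n + 1) := by push_cast; rfl
    rw [hcast, Complex.re_ofReal_mul, ← mul_sub]
    exact mul_nonneg (by positivity) (by linarith)

lemma norm_pbarGen_le {q : ℂ} (hq : ‖q‖ < 1) :
    ‖pbarGen q‖ ≤ ‖pbarGen (‖q‖ : ℂ)‖ *
      Real.exp (-(2 * (‖q‖ / (1 - ‖q‖) - (q / (1 - q)).re))) := by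
  have hr : ‖(‖q‖ : ℂ)‖ < 1 := by simpa using hq
  have hp1 := (hasProd_pbar hq).2.norm
  have hp2 := (hasProd_pbar hr).2.norm
  have hg1 : HasSum (fun n : ℕ ↦ ‖q‖ ^ (n + 1)) (‖q‖ / (1 - ‖q‖)) := by
    simpa [pow_succ', div_eq_mul_inv] using
      (hasSum_geometric_of_lt_one (norm_nonneg q) hq).mul_left ‖q‖
  have hg2 : HasSum (fun n : ℕ ↦ (q ^ (n + 1)).re) (q / (1 - q)).re := by
    have : HasSum (fun n : ℕ ↦ q ^ (n + 1)) (q / (1 - q)) := by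
      simpa [pow_succ', div_eq_mul_inv] using (hasSum_geometric_of_norm_lt_one hq).mul_left q
    exact Complex.hasSum_re this
  have hs := (hg1.sub hg2).mul_left 2
  have he := hp2.mul hs.neg.rexp
  refine le_of_tendsto_of_tendsto' hp1 he fun s ↦ ?_
  refine Finset.prod_le_prod (fun _ _ ↦ norm_nonneg _) fun i _ ↦ ?_
  have hlt : ‖q ^ (i + 1)‖ < 1 := by
    rw [norm_pow]
    exact pow_lt_one₀ (norm_nonneg _) hq (by omega)
  have h := norm_one_add_div_one_sub_le hlt
  have hn : ‖(1 + (‖q‖ : ℂ) ^ (i + 1)) / (1 - (‖q‖ : ℂ) ^ (i + 1))‖ =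
      (1 + ‖q ^ (i + 1)‖) / (1 - ‖q ^ (i + 1)‖) := by
    have : (1 + (‖q‖ : ℂ) ^ (i + 1)) / (1 - (‖q‖ : ℂ) ^ (i + 1)) =
        (((1 + ‖q ^ (i + 1)‖) / (1 - ‖q ^ (i + 1)‖) : ℝ) : ℂ) := by
      push_cast [norm_pow]
      rfl
    rw [this, Complex.norm_real, Real.norm_of_nonneg]
    exact div_nonneg (by positivity) (by linarith)
  simp only [Function.comp_apply]
  rw [hn]
  rw [norm_pow] at h ⊢
  exact h

/-! ### A primitive of the generating function and Cauchy's formula -/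

/-- Termwise primitive of `pbar m * exp ((n - m) z)`. -/
noncomputable def primTerm (n m : ℕ) (z : ℂ) : ℂ :=
  (pbar m : ℂ) * (if m = n then z else Complex.exp (((n : ℂ) - m) * z) / ((n : ℂ) - m))

/-- A primitive of `z ↦ pbarGen (exp (-z)) * exp (n z)`. -/
noncomputable def pbarPrim (n : ℕ) (z : ℂ) : ℂ := ∑' m, primTerm n m z

lemma hasDerivAt_primTerm (n m : ℕ) (z : ℂ) :
    HasDerivAt (primTerm n m) ((pbar m : ℂ) * Complex.exp (((n : ℂ) - m) * z)) z := by
  unfold primTerm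
  refine HasDerivAt.const_mul _ ?_
  split_ifs with h
  · subst h
    simpa using hasDerivAt_id' z
  · have hne : (n : ℂ) - m ≠ 0 := sub_ne_zero.mpr (by exact_mod_cast Ne.symm h)
    have := ((hasDerivAt_id z).const_mul ((n : ℂ) - m)).cexp.div_const ((n : ℂ) - m)
    simpa [mul_div_assoc, hne] using this

lemma summable_pbar_mul_exp {δ : ℝ} (hδ : 0 < δ) :
    Summable fun m : ℕ ↦ (pbar m : ℝ) * Real.exp (-(m * δ)) := by
  have hq : ‖((Real.exp (-δ) : ℝ) : ℂ)‖ < 1 := by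
    rw [Complex.norm_real, Real.norm_of_nonneg (Real.exp_pos _).le, Real.exp_lt_one_iff]
    linarith
  have := (hasProd_pbar hq).1
  rw [Complex.norm_real, Real.norm_of_nonneg (Real.exp_pos _).le] at this
  refine this.congr fun m ↦ ?_
  rw [← Real.exp_nat_mul]
  ring_nf

lemma norm_exp_sub_mul_le (n m : ℕ) {δ R : ℝ} {z : ℂ} (h1 : δ ≤ z.re) (h2 : z.re ≤ R) :
    ‖Complex.exp (((n : ℂ) - m) * z)‖ ≤ Real.exp (n * R) * Real.exp (-(m * δ)) := by
  rw [Complex.norm_exp, ← Real.exp_add]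
  refine Real.exp_le_exp.mpr ?_
  have : (((n : ℂ) - m) * z).re = n * z.re - m * z.re := by simp; ring
  rw [this]
  have a1 := mul_le_mul_of_nonneg_left h2 (Nat.cast_nonneg (α := ℝ) n)
  have a2 := mul_le_mul_of_nonneg_left h1 (Nat.cast_nonneg (α := ℝ) m)
  linarith

lemma summable_primTerm (n : ℕ) {z : ℂ} (hz : 0 < z.re) : Summable fun m ↦ primTerm n m z := by
  have h := ((summable_pbar_mul_exp hz).mul_left (Real.exp (n * z.re)))
  have h' : Summable fun m ↦ ‖primTerm n m z‖ := by
    refine (summable_nat_add_iff (n + 1)).mp ?_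
    refine Summable.of_nonneg_of_le (fun _ ↦ norm_nonneg _) (fun k ↦ ?_)
      ((summable_nat_add_iff (n + 1)).mpr h)
    have hk : k + (n + 1) ≠ n := by omega
    have h1 : 1 ≤ ‖(n : ℂ) - ((k + (n + 1) : ℕ) : ℂ)‖ := by
      have : (n : ℂ) - ((k + (n + 1) : ℕ) : ℂ) = -((k + 1 : ℕ) : ℂ) := by push_cast; ring
      rw [this, norm_neg, Complex.norm_natCast]
      exact_mod_cast Nat.succ_le_succ (Nat.zero_le k)
    rw [primTerm, if_neg hk, norm_mul, norm_div, Complex.norm_natCast]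
    have h2 := norm_exp_sub_mul_le n (k + (n + 1)) le_rfl (le_refl z.re)
    have h3 : ‖Complex.exp (((n : ℂ) - ((k + (n + 1) : ℕ) : ℂ)) * z)‖ /
        ‖(n : ℂ) - ((k + (n + 1) : ℕ) : ℂ)‖ ≤
          Real.exp (n * z.re) * Real.exp (-(((k + (n + 1) : ℕ) : ℝ) * z.re)) :=
      (div_le_self (norm_nonneg _) h1).trans h2
    calc _ ≤ (pbar (k + (n + 1)) : ℝ) *
          (Real.exp (n * z.re) * Real.exp (-(((k + (n + 1) : ℕ) : ℝ) * z.re))) :=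
          mul_le_mul_of_nonneg_left h3 (Nat.cast_nonneg _)
      _ = _ := by ring
  exact h'.of_norm

lemma tsum_pbar_mul_exp (n : ℕ) (z : ℂ) :
    ∑' m : ℕ, (pbar m : ℂ) * Complex.exp (((n : ℂ) - m) * z) =
      pbarGen (Complex.exp (-z)) * Complex.exp (n * z) := by
  rw [pbarGen, ← tsum_mul_right]
  congr 1
  funext m
  rw [← Complex.exp_nat_mul, mul_assoc, ← Complex.exp_add]
  ring_nf

lemma hasDerivAt_pbarPrim (n : ℕ) {z : ℂ} (hz : 0 < z.re) :
    HasDerivAt (pbarPrim n) (pbarGen (Complex.exp (-z)) * Complex.exp (n * z)) z := by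
  set S : Set ℂ := {w | z.re / 2 < w.re} ∩ {w | w.re < z.re + 1}
  have hS : IsOpen S := (isOpen_lt continuous_const Complex.continuous_re).inter
    (isOpen_lt Complex.continuous_re continuous_const)
  have hSc : Convex ℝ S := (convex_halfSpace_re_gt _).inter (convex_halfSpace_re_lt _)
  have hzS : z ∈ S := ⟨by change z.re / 2 < z.re; linarith, by change z.re < z.re + 1; linarith⟩
  have hu := (summable_pbar_mul_exp (half_pos hz)).mul_left (Real.exp (n * (z.re + 1)))
  have := hasDerivAt_tsum_of_isPreconnected (g := primTerm n)
    (g' := fun m z ↦ (pbar m : ℂ) * Complex.exp (((n : ℂ) - m) * z)) hu hS hSc.isPreconnected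
    (fun m y _ ↦ hasDerivAt_primTerm n m y) (fun m y hy ↦ ?_) hzS (summable_primTerm n hz) hzS
  · rw [tsum_pbar_mul_exp] at this
    exact this
  · rw [norm_mul, Complex.norm_natCast]
    have h2 := norm_exp_sub_mul_le n m hy.1.le hy.2.le
    calc _ ≤ (pbar m : ℝ) * (Real.exp (n * (z.re + 1)) * Real.exp (-((m : ℝ) * (z.re / 2)))) :=
          mul_le_mul_of_nonneg_left h2 (Nat.cast_nonneg _)
      _ = _ := by ring

lemma pbarPrim_sub (n : ℕ) {s : ℝ} (hs : 0 < s) :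
    pbarPrim n (s + π * Complex.I) - pbarPrim n (s - π * Complex.I) =
      2 * π * Complex.I * pbar n := by
  have h1 : 0 < ((s : ℂ) + π * Complex.I).re := by simpa
  have h2 : 0 < ((s : ℂ) - π * Complex.I).re := by simpa
  rw [pbarPrim, pbarPrim, ← (summable_primTerm n h1).tsum_sub (summable_primTerm n h2),
    tsum_eq_single n]
  · simp only [primTerm, if_true]
    ring
  · intro m hm
    rw [primTerm, primTerm, if_neg hm, if_neg hm]
    have : ((n : ℂ) - m) * (s + π * Complex.I) =
        ((n : ℂ) - m) * (s - π * Complex.I) + ((n - m : ℤ) : ℂ) * (2 * π * Complex.I) := by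
      push_cast
      ring
    rw [this, Complex.exp_add, Complex.exp_int_mul_two_pi_mul_I, mul_one, sub_self]

lemma inv_sub_re_eq {q : ℂ} (hq : ‖q‖ < 1) :
    ‖q‖ / (1 - ‖q‖) - (q / (1 - q)).re =
      (‖q‖ - q.re) * (1 + ‖q‖) / ((1 - ‖q‖) * ((1 - ‖q‖) ^ 2 + 2 * (‖q‖ - q.re))) := by
  have hre : q.re ≤ ‖q‖ := Complex.re_le_norm q
  have hsq : q.re * q.re + q.im * q.im = ‖q‖ ^ 2 := by
    rw [← Complex.normSq_eq_norm_sq, Complex.normSq_apply]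
  have h1 : 0 < 1 - ‖q‖ := by linarith
  have hns : Complex.normSq (1 - q) = (1 - ‖q‖) ^ 2 + 2 * (‖q‖ - q.re) := by
    rw [Complex.normSq_apply]
    simp only [Complex.sub_re, Complex.sub_im, Complex.one_re, Complex.one_im]
    linear_combination hsq
  have hpos : 0 < (1 - ‖q‖) ^ 2 + 2 * (‖q‖ - q.re) := by nlinarith
  have hdiv : (q / (1 - q)).re = (q.re - ‖q‖ ^ 2) / ((1 - ‖q‖) ^ 2 + 2 * (‖q‖ - q.re)) := by
    rw [Complex.div_re, hns, ← add_div]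
    congr 1
    simp only [Complex.sub_re, Complex.sub_im, Complex.one_re, Complex.one_im]
    linear_combination -hsq
  rw [hdiv]
  field_simp
  ring

/-- The generating function is small on vertical lines away from the real axis. -/
lemma saving_ge {z : ℂ} (h0 : 0 < z.re) (h1 : z.re ≤ 107 / 10000) (h2 : 3 * z.re ^ 2 ≤ z.im ^ 2)
    (h3 : |z.im| ≤ π) :
    1075 / 1000 / z.re ≤ 2 * (‖Complex.exp (-z)‖ / (1 - ‖Complex.exp (-z)‖) -
      (Complex.exp (-z) / (1 - Complex.exp (-z))).re) := by
  rw [inv_sub_re_eq (norm_exp_neg_lt_one h0)]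
  have hn : ‖Complex.exp (-z)‖ = Real.exp (-z.re) := by rw [Complex.norm_exp, Complex.neg_re]
  have hre : (Complex.exp (-z)).re = Real.exp (-z.re) * Real.cos z.im := by
    rw [Complex.exp_re, Complex.neg_re, Complex.neg_im, Real.cos_neg]
  rw [hn, hre]
  set s := z.re
  set y := z.im
  have hr1 : 1 - s ≤ Real.exp (-s) := by linarith [Real.add_one_le_exp (-s)]
  have hr2 : Real.exp (-s) < 1 := by
    rw [Real.exp_lt_one_iff]
    linarith
  set r := Real.exp (-s)
  have hcos := Real.cos_le_one_sub_mul_cos_sq h3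
  have hpi : π ^ 2 ≤ 987 / 100 := by nlinarith [Real.pi_lt_d4, Real.pi_gt_three]
  have hd : 6 * (r * s ^ 2) / (987 / 100) ≤ r - r * Real.cos y := by
    have e1 : 2 / π ^ 2 * y ^ 2 ≤ 1 - Real.cos y := by linarith
    have e2 : 2 / (987 / 100) * (3 * s ^ 2) ≤ 2 / π ^ 2 * y ^ 2 := by
      gcongr
    have e3 : 0 ≤ r := (Real.exp_pos _).le
    have := mul_le_mul_of_nonneg_left (e2.trans e1) e3
    linarith
  set d := r - r * Real.cos y
  have hd' : 601 / 1000 * s ^ 2 ≤ d := by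
    refine le_trans ?_ hd
    rw [le_div_iff₀ (by norm_num)]
    nlinarith [sq_nonneg s]
  have hsr : 0 < 1 - r := by linarith
  have hdpos : 0 < d := lt_of_lt_of_le (by positivity) hd'
  rw [← mul_div_assoc, div_le_div_iff₀ h0 (by positivity)]
  have hb : (1 - r) * ((1 - r) ^ 2 + 2 * d) ≤ s * (s ^ 2 + 2 * d) := by
    have : (1 - r) ^ 2 ≤ s ^ 2 := pow_le_pow_left₀ hsr.le (by linarith) 2
    exact mul_le_mul (by linarith) (by linarith) (by positivity) h0.le
  have hc : 1075 / 1000 * (s ^ 2 + 2 * d) ≤ 2 * (d * (1 + r)) := by nlinarith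
  nlinarith

lemma norm_integrand_vertical_le {t : ℝ} (ht : 74 ≤ t) {z : ℂ} (hz : z.re = π / (4 * t))
    (h2 : 3 * z.re ^ 2 ≤ z.im ^ 2) (h3 : |z.im| ≤ π) :
    ‖pbarGen (Complex.exp (-z)) * Complex.exp ((t ^ 2 : ℝ) * z)‖ ≤
      Real.exp (π * t - 58 / 100 * t) := by
  have hpi := Real.pi_lt_d4
  have hpi3 := Real.pi_gt_d4
  have hz0 : 0 < z.re := by rw [hz]; positivity
  have hzs : z.re ≤ 107 / 10000 := by
    rw [hz, div_le_iff₀ (by positivity)]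
    linarith
  have hq := norm_exp_neg_lt_one hz0
  have hs := saving_ge hz0 hzs h2 h3
  have h := norm_pbarGen_le hq
  have hn : ‖Complex.exp (-z)‖ = Real.exp (-z.re) := by rw [Complex.norm_exp, Complex.neg_re]
  have hreal : ((‖Complex.exp (-z)‖ : ℝ) : ℂ) = Complex.exp (-(z.re : ℂ)) := by
    rw [hn]
    push_cast
    rfl
  have hzr : 0 < ((z.re : ℝ) : ℂ).re := by simpa using hz0
  have hgen : ‖pbarGen ((‖Complex.exp (-z)‖ : ℝ) : ℂ)‖ ≤ Real.exp (π * t) := by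
    rw [hreal, pbarGen_exp_neg hzr, norm_mul, norm_mul, norm_mul]
    have a1 : ‖(1 / 2 : ℂ)‖ = 1 / 2 := by norm_num
    have a2 : ‖Complex.sqrt ((z.re : ℂ) / π)‖ ≤ 1 := by
      have := complex_sqrt_sq ((z.re : ℂ) / π)
      have h' : ‖Complex.sqrt ((z.re : ℂ) / π)‖ ^ 2 = z.re / π := by
        rw [← norm_pow, this, ← Complex.ofReal_div, Complex.norm_real, Real.norm_of_nonneg]
        positivity
      have h'' : z.re / π ≤ 1 := by
        rw [div_le_one pi_pos]
        linarith
      nlinarith [norm_nonneg (Complex.sqrt ((z.re : ℂ) / π))]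
    have a3 : ‖Complex.exp (π ^ 2 / (4 * (z.re : ℂ)))‖ = Real.exp (π * t) := by
      rw [Complex.norm_exp]
      congr 1
      have : ((π : ℂ) ^ 2 / (4 * (z.re : ℂ))) = ((π * t : ℝ) : ℂ) := by
        rw [hz]
        push_cast
        have hpi : (π : ℂ) ≠ 0 := Complex.ofReal_ne_zero.mpr pi_ne_zero
        have ht : (t : ℂ) ≠ 0 := Complex.ofReal_ne_zero.mpr (by linarith)
        field_simp
      rw [this, Complex.ofReal_re]
    have a4 : ‖modRatio (Complex.exp (-(2 * (π : ℂ) ^ 2 / (z.re : ℂ))))‖ ≤ 2 := by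
      have hx : ‖Complex.exp (-(2 * (π : ℂ) ^ 2 / (z.re : ℂ)))‖ ≤ 1 / 100 := by
        have : -(2 * (π : ℂ) ^ 2 / (z.re : ℂ)) = ((-(8 * π * t) : ℝ) : ℂ) := by
          rw [hz]
          push_cast
          have hpi : (π : ℂ) ≠ 0 := Complex.ofReal_ne_zero.mpr pi_ne_zero
          have ht : (t : ℂ) ≠ 0 := Complex.ofReal_ne_zero.mpr (by linarith)
          field_simp
          norm_num
        rw [this, ← Complex.ofReal_exp, Complex.norm_real, Real.norm_of_nonneg (Real.exp_pos _).le,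
          Real.exp_neg, inv_le_comm₀ (Real.exp_pos _) (by norm_num)]
        have := Real.add_one_le_exp (8 * π * t)
        nlinarith
      have := norm_modRatio_sub_one_le hx
      have h' := norm_sub_norm_le (modRatio (Complex.exp (-(2 * (π : ℂ) ^ 2 / (z.re : ℂ))))) 1
      rw [norm_one] at h'
      linarith
    rw [a1, a3]
    calc _ ≤ 1 / 2 * 1 * Real.exp (π * t) * 2 := by gcongr
      _ = _ := by ring
  have he : ‖Complex.exp ((t ^ 2 : ℝ) * z)‖ = Real.exp (π * t / 4) := by
    rw [Complex.norm_exp, Complex.re_ofReal_mul, hz]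
    congr 1
    field_simp
  rw [norm_mul, he]
  have hs' : 4 * (1075 / 1000) * t / π ≤ 1075 / 1000 / z.re := by
    rw [hz]
    apply le_of_eq
    field_simp
  have hs'' : 1367 / 1000 * t ≤ 4 * (1075 / 1000) * t / π := by
    rw [le_div_iff₀ pi_pos]
    nlinarith
  calc _ ≤ Real.exp (π * t) * Real.exp (-(2 * (‖Complex.exp (-z)‖ / (1 - ‖Complex.exp (-z)‖) -
      (Complex.exp (-z) / (1 - Complex.exp (-z))).re))) * Real.exp (π * t / 4) := by
        refine mul_le_mul_of_nonneg_right (h.trans ?_) (Real.exp_pos _).le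
        exact mul_le_mul_of_nonneg_right hgen (Real.exp_pos _).le
    _ ≤ _ := by
        rw [← Real.exp_add, ← Real.exp_add]
        refine Real.exp_le_exp.mpr ?_
        have : π * t ≤ 31416 / 10000 * t := mul_le_mul_of_nonneg_right (by linarith) (by linarith)
        linarith

/-! ### The saddle point arc -/

/-- Incomplete Gaussian integral. -/
noncomputable def gaussInt (b x : ℝ) : ℝ := ∫ u in (0 : ℝ)..x, Real.exp (-b * u ^ 2)

lemma hasDerivAt_gaussInt (b x : ℝ) : HasDerivAt (gaussInt b) (Real.exp (-b * x ^ 2)) x := by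
  have hc : Continuous fun u : ℝ ↦ Real.exp (-b * u ^ 2) := by fun_prop
  exact (hc.integral_hasStrictDerivAt 0 x).hasDerivAt

lemma gaussInt_neg (b x : ℝ) : gaussInt b (-x) = -gaussInt b x := by
  have h := intervalIntegral.integral_comp_neg (a := 0) (b := x) fun u ↦ Real.exp (-b * u ^ 2)
  simp only [neg_sq, neg_zero] at h
  rw [gaussInt, intervalIntegral.integral_symm, ← h, gaussInt]

lemma gaussInt_half {b : ℝ} (hb : 0 < b) :
    √(π / b) / 2 - 2 / b * Real.exp (-b / 4) ≤ gaussInt b (1 / 2) ∧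
      gaussInt b (1 / 2) ≤ √(π / b) / 2 := by
  have hgauss := (integrable_exp_neg_mul_sq hb)
  have h1 := intervalIntegral.integral_interval_add_Ioi (a := 0) (b := 1 / 2)
    (f := fun x : ℝ ↦ Real.exp (-b * x ^ 2)) hgauss.integrableOn hgauss.integrableOn
  rw [integral_gaussian_Ioi] at h1
  have h0 : 0 ≤ ∫ x in Set.Ioi (1 / 2 : ℝ), Real.exp (-b * x ^ 2) :=
    MeasureTheory.integral_nonneg fun _ ↦ (Real.exp_pos _).le
  have hneg : -(b / 2) < 0 := by linarith
  have h2 : ∫ x in Set.Ioi (1 / 2 : ℝ), Real.exp (-b * x ^ 2) ≤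
      ∫ x in Set.Ioi (1 / 2 : ℝ), Real.exp (-(b / 2) * x) := by
    refine MeasureTheory.setIntegral_mono_on hgauss.integrableOn
      (integrableOn_exp_mul_Ioi hneg _) measurableSet_Ioi fun x hx ↦ ?_
    refine Real.exp_le_exp.mpr ?_
    have hx' : 1 / 2 < x := hx
    have : 0 ≤ b * (x * (x - 1 / 2)) :=
      mul_nonneg hb.le (mul_nonneg (by linarith) (by linarith))
    nlinarith
  rw [integral_exp_mul_Ioi hneg] at h2
  have h3 : -Real.exp (-(b / 2) * (1 / 2)) / -(b / 2) = 2 / b * Real.exp (-b / 4) := by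
    rw [show -(b / 2) * (1 / 2) = -b / 4 by ring]
    field_simp
  rw [h3] at h2
  rw [gaussInt]
  constructor <;> linarith

/-- A primitive of `2 (1 - 4 x ^ 2) exp (-2 μ x ^ 2)`. -/
noncomputable def saddlePrim (μ x : ℝ) : ℝ :=
  2 / μ * x * Real.exp (-(2 * μ) * x ^ 2) + 2 * (1 - 1 / μ) * gaussInt (2 * μ) x

lemma hasDerivAt_saddlePrim {μ : ℝ} (hμ : μ ≠ 0) (x : ℝ) :
    HasDerivAt (saddlePrim μ) (2 * (1 - 4 * x ^ 2) * Real.exp (-(2 * μ) * x ^ 2)) x := by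
  have h1 : HasDerivAt (fun x : ℝ ↦ Real.exp (-(2 * μ) * x ^ 2))
      (Real.exp (-(2 * μ) * x ^ 2) * (-(2 * μ) * (2 * x))) x := by
    simpa using ((hasDerivAt_pow 2 x).const_mul (-(2 * μ))).exp
  have h2 := (((hasDerivAt_id' x).const_mul (2 / μ)).mul h1).add
    ((hasDerivAt_gaussInt (2 * μ) x).const_mul (2 * (1 - 1 / μ)))
  refine h2.congr_deriv ?_
  field_simp
  ring

lemma saddlePrim_half {μ : ℝ} (hμ : 6 ≤ μ) :
    |saddlePrim μ (1 / 2) - saddlePrim μ (-(1 / 2)) - 2 * (1 - 1 / μ) * √(π / (2 * μ))| ≤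
      Real.exp (-μ / 2) := by
  obtain ⟨h1, h2⟩ := gaussInt_half (show 0 < 2 * μ by linarith)
  rw [saddlePrim, saddlePrim, gaussInt_neg, neg_sq,
    show -(2 * μ) * (1 / 2) ^ 2 = -μ / 2 by ring]
  rw [show -(2 * μ) / 4 = -μ / 2 by ring] at h1
  have he := Real.exp_pos (-μ / 2)
  have hm : 0 ≤ 1 / μ := by positivity
  have hm' : 1 / μ ≤ 1 / 6 := one_div_le_one_div_of_le (by norm_num) hμ
  rw [show 2 / (2 * μ) = 1 / μ by field_simp] at h1
  rw [show 2 / μ = 2 * (1 / μ) by field_simp]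
  set m := 1 / μ
  set e := Real.exp (-μ / 2)
  set g := gaussInt (2 * μ) (1 / 2)
  set w := √(π / (2 * μ))
  rw [show 2 * m * (1 / 2) * e + 2 * (1 - m) * g -
    (2 * m * (-(1 / 2)) * e + 2 * (1 - m) * -g) - 2 * (1 - m) * w =
      2 * m * e - 4 * (1 - m) * (w / 2 - g) by ring]
  have a1 : 0 ≤ 4 * (1 - m) * (w / 2 - g) := mul_nonneg (by linarith) (by linarith)
  have a2 : 4 * (1 - m) * (w / 2 - g) ≤ 4 * 1 * (m * e) :=
    mul_le_mul (by linarith) (by linarith) (by linarith) (by norm_num)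
  have a3 : m * e ≤ 1 / 6 * e := mul_le_mul_of_nonneg_right hm' he.le
  rw [abs_le]
  constructor <;> linarith

lemma hasDerivAt_saddlePrim_sin {μ : ℝ} (hμ : μ ≠ 0) (θ : ℝ) :
    HasDerivAt (fun θ ↦ saddlePrim μ (Real.sin (θ / 2)))
      (Real.cos (3 * θ / 2) * Real.exp (μ * Real.cos θ - μ)) θ := by
  have h1 : HasDerivAt (fun θ : ℝ ↦ Real.sin (θ / 2)) (Real.cos (θ / 2) * (1 / 2)) θ := by
    have := ((hasDerivAt_id' θ).div_const 2).sin
    simpa using this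
  have h2 := (hasDerivAt_saddlePrim hμ (Real.sin (θ / 2))).comp θ h1
  refine h2.congr_deriv ?_
  have hc : Real.cos θ = 1 - 2 * Real.sin (θ / 2) ^ 2 := by
    rw [← Real.cos_sq_add_sin_sq (θ / 2)]
    conv_lhs => rw [show θ = 2 * (θ / 2) by ring, Real.cos_two_mul']
    ring
  have hc3 : Real.cos (3 * θ / 2) = Real.cos (θ / 2) * (1 - 4 * Real.sin (θ / 2) ^ 2) := by
    rw [show 3 * θ / 2 = 3 * (θ / 2) by ring, Real.cos_three_mul, Real.sin_sq]
    ring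
  rw [hc3, hc, show μ * (1 - 2 * Real.sin (θ / 2) ^ 2) - μ =
    -(2 * μ) * Real.sin (θ / 2) ^ 2 by ring]
  ring

lemma integrand_arc {t θ : ℝ} (ht : 1 ≤ t) (hθ : |θ| ≤ π / 3) :
    ‖pbarGen (Complex.exp (-((π / (2 * t) : ℝ) * Complex.exp (θ * Complex.I)))) *
        Complex.exp ((t ^ 2 : ℝ) * ((π / (2 * t) : ℝ) * Complex.exp (θ * Complex.I))) *
        ((π / (2 * t) : ℝ) * (Complex.exp (θ * Complex.I) * Complex.I)) -
      ((1 / 2 * √(1 / (2 * t)) * (π / (2 * t)) * Real.exp (π * t * Real.cos θ) : ℝ) : ℂ) *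
        (Complex.I * Complex.exp ((3 * θ / 2 : ℝ) * Complex.I))‖ ≤
      1 / 2 * √(1 / (2 * t)) * (π / (2 * t)) * 2 * Real.exp (-(π * t)) := by
  have hpi0 : (π : ℂ) ≠ 0 := Complex.ofReal_ne_zero.mpr pi_ne_zero
  have ht0 : 0 < t := by linarith
  have htc : (t : ℂ) ≠ 0 := Complex.ofReal_ne_zero.mpr ht0.ne'
  have hcos : 1 / 2 ≤ Real.cos θ := by
    rw [← Real.cos_pi_div_three, ← Real.cos_abs θ]
    exact Real.cos_le_cos_of_nonneg_of_le_pi (abs_nonneg _) (by linarith [pi_pos]) hθ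
  set z : ℂ := (π / (2 * t) : ℝ) * Complex.exp (θ * Complex.I) with hzdef
  have hz : 0 < z.re := by
    rw [hzdef, Complex.re_ofReal_mul, Complex.exp_ofReal_mul_I_re]
    have : 0 < Real.cos θ := by linarith
    positivity
  have hz0 : z ≠ 0 := by
    rintro h
    rw [h] at hz
    simp at hz
  have hinv : (Complex.exp (θ * Complex.I))⁻¹ = Complex.exp (-(θ * Complex.I)) :=
    (Complex.exp_neg _).symm
  have hsqrt : Complex.sqrt (z / π) =
      (√(1 / (2 * t)) : ℝ) * Complex.exp ((θ / 2 : ℝ) * Complex.I) := by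
    have e1 : z / π = Complex.exp ((Real.log (1 / (2 * t)) : ℝ) + θ * Complex.I) := by
      rw [Complex.exp_add, ← Complex.ofReal_exp, Real.exp_log (by positivity), hzdef]
      push_cast
      field_simp
    have hne : z / π ≠ 0 := div_ne_zero hz0 hpi0
    have hth := abs_le.mp hθ
    rw [sqrt_eq_exp hne, e1, Complex.log_exp]
    · rw [add_div, Complex.exp_add]
      congr 1
      · rw [Real.sqrt_eq_rpow, Real.rpow_def_of_pos (by positivity)]
        push_cast
        congr 1
        ring
      · push_cast
        congr 1
        ring
    · simp
      linarith [pi_pos]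
    · simp
      linarith [pi_pos]
  have hsaddle : Complex.exp (π ^ 2 / (4 * z)) * Complex.exp ((t ^ 2 : ℝ) * z) =
      ((Real.exp (π * t * Real.cos θ) : ℝ) : ℂ) := by
    rw [← Complex.exp_add, Complex.ofReal_exp]
    congr 1
    have : (π : ℂ) ^ 2 / (4 * z) = π * t / 2 * Complex.exp (-(θ * Complex.I)) := by
      rw [← hinv, hzdef]
      push_cast
      field_simp
      norm_num
    rw [this, hzdef]
    push_cast
    rw [Complex.cos]
    field_simp
    ring_nf
  have hx : ‖Complex.exp (-(2 * (π : ℂ) ^ 2 / z))‖ ≤ Real.exp (-(2 * (π * t))) := by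
    rw [Complex.norm_exp]
    refine Real.exp_le_exp.mpr ?_
    have : -(2 * (π : ℂ) ^ 2 / z) = ((-(4 * π * t) : ℝ) : ℂ) *
        Complex.exp ((-θ : ℝ) * Complex.I) := by
      rw [show ((-θ : ℝ) : ℂ) * Complex.I = -(θ * Complex.I) by push_cast; ring, ← hinv, hzdef]
      push_cast
      field_simp
      norm_num
    rw [this, Complex.re_ofReal_mul, Complex.exp_ofReal_mul_I_re, Real.cos_neg]
    have : 0 < π * t := by positivity
    nlinarith
  have hx' : Real.exp (-(2 * (π * t))) ≤ 1 / 100 := by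
    have h1 : π * 1 ≤ π * t := mul_le_mul_of_nonneg_left ht pi_pos.le
    have h2 : Real.exp (-(2 * (π * t))) ≤ Real.exp (-6) :=
      Real.exp_le_exp.mpr (by linarith [Real.pi_gt_three])
    have h3 : Real.exp (-6) ≤ 1 / 100 := by
      rw [Real.exp_neg, inv_le_comm₀ (Real.exp_pos _) (by norm_num),
        show (6 : ℝ) = (6 : ℕ) * 1 by norm_num, Real.exp_nat_mul]
      have := Real.exp_one_gt_d9
      calc (1 / 100 : ℝ)⁻¹ ≤ 2.7 ^ 6 := by norm_num
        _ ≤ _ := by gcongr; linarith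
    linarith
  have hmod := (norm_modRatio_sub_one_le (hx.trans hx')).trans
    (mul_le_mul_of_nonneg_left hx zero_le_two)
  rw [pbarGen_exp_neg hz, hsqrt]
  set m := modRatio (Complex.exp (-(2 * (π : ℂ) ^ 2 / z)))
  have hkey : 1 / 2 * ((√(1 / (2 * t)) : ℝ) * Complex.exp ((θ / 2 : ℝ) * Complex.I)) *
        Complex.exp (π ^ 2 / (4 * z)) * m * Complex.exp ((t ^ 2 : ℝ) * z) *
        ((π / (2 * t) : ℝ) * (Complex.exp (θ * Complex.I) * Complex.I)) -
      ((1 / 2 * √(1 / (2 * t)) * (π / (2 * t)) * Real.exp (π * t * Real.cos θ) : ℝ) : ℂ) *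
        (Complex.I * Complex.exp ((3 * θ / 2 : ℝ) * Complex.I)) =
      ((1 / 2 * √(1 / (2 * t)) * (π / (2 * t)) * Real.exp (π * t * Real.cos θ) : ℝ) : ℂ) *
        (Complex.I * Complex.exp ((3 * θ / 2 : ℝ) * Complex.I)) * (m - 1) := by
    have e3 : Complex.exp ((3 * θ / 2 : ℝ) * Complex.I) =
        Complex.exp ((θ / 2 : ℝ) * Complex.I) * Complex.exp (θ * Complex.I) := by
      rw [← Complex.exp_add]
      congr 1
      push_cast
      ring
    rw [e3]
    simp only [Complex.ofReal_mul]
    rw [← hsaddle]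
    push_cast
    ring
  rw [hkey, norm_mul, norm_mul, norm_mul, Complex.norm_exp_ofReal_mul_I, Complex.norm_I,
    Complex.norm_real, Real.norm_of_nonneg (by positivity)]
  have hle : Real.exp (π * t * Real.cos θ) ≤ Real.exp (π * t) := by
    refine Real.exp_le_exp.mpr ?_
    have : 0 < π * t := by positivity
    nlinarith [Real.cos_le_one θ]
  set C := 1 / 2 * √(1 / (2 * t)) * (π / (2 * t))
  calc C * Real.exp (π * t * Real.cos θ) * (1 * 1) * ‖m - 1‖
      ≤ C * Real.exp (π * t) * (1 * 1) * (2 * Real.exp (-(2 * (π * t)))) := by gcongr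
    _ = C * 2 * (Real.exp (π * t) * Real.exp (-(2 * (π * t)))) := by ring
    _ = _ := by
      rw [← Real.exp_add]
      ring_nf

/-! ### The asymptotic expansion of `pbar` -/

lemma ten_pow_decay {t : ℝ} (ht : 74 ≤ t) :
    16 * t ^ 2 * Real.exp (-(58 / 100 * t)) ≤ 100 / t ^ 8 := by
  have h1 : t / (12 / 10) ≤ Real.exp (58 / 1000 * t) := by
    have e1 : (73 : ℝ) ≤ Real.exp (43 / 10) := by
      have a1 : (1.3495 : ℝ) ≤ Real.exp (3 / 10) := by
        refine le_trans ?_ (Real.sum_le_exp_of_nonneg (show (0 : ℝ) ≤ 3 / 10 by norm_num) 4)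
        norm_num [Finset.sum_range_succ, Nat.factorial]
      have a2 : (2.718 : ℝ) ^ 4 ≤ Real.exp 4 := by
        rw [show (4 : ℝ) = (4 : ℕ) * 1 by norm_num, Real.exp_nat_mul]
        have := Real.exp_one_gt_d9
        gcongr
        linarith
      rw [show (43 / 10 : ℝ) = 4 + 3 / 10 by norm_num, Real.exp_add]
      calc (73 : ℝ) ≤ 2.718 ^ 4 * 1.3495 := by norm_num
        _ ≤ _ := by gcongr
    have e2 := Real.add_one_le_exp (58 / 1000 * t - 43 / 10)
    calc t / (12 / 10) ≤ 73 * (58 / 1000 * t - 43 / 10 + 1) := by linarith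
      _ ≤ Real.exp (43 / 10) * Real.exp (58 / 1000 * t - 43 / 10) := by
        refine mul_le_mul e1 e2 (by linarith) (Real.exp_pos _).le
      _ = _ := by
        rw [← Real.exp_add]
        congr 1
        ring
  have h2 : (t / (12 / 10)) ^ 10 ≤ Real.exp (58 / 100 * t) := by
    have := pow_le_pow_left₀ (by linarith) h1 10
    rw [← Real.exp_nat_mul] at this
    rwa [show ((10 : ℕ) : ℝ) * (58 / 1000 * t) = 58 / 100 * t by push_cast; ring] at this
  rw [Real.exp_neg, ← div_eq_mul_inv, div_le_div_iff₀ (Real.exp_pos _) (by positivity)]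
  rw [div_pow, div_le_iff₀ (by norm_num)] at h2
  calc 16 * t ^ 2 * t ^ 8 = 16 * t ^ 10 := by ring
    _ ≤ 16 * (Real.exp (58 / 100 * t) * (12 / 10) ^ 10) := by linarith
    _ ≤ _ := by nlinarith [Real.exp_pos (58 / 100 * t)]

lemma norm_pbarPrim_sub_vertical {n : ℕ} {t : ℝ} (ht : 74 ≤ t) (hn : t ^ 2 = n) {K : Set ℝ}
    (hK : Convex ℝ K) (hK1 : ∀ y ∈ K, 3 * (π / (4 * t)) ^ 2 ≤ y ^ 2 ∧ |y| ≤ π) {a b : ℝ}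
    (ha : a ∈ K) (hb : b ∈ K) (hab : |b - a| ≤ π) :
    ‖pbarPrim n ((π / (4 * t) : ℝ) + b * Complex.I) -
      pbarPrim n ((π / (4 * t) : ℝ) + a * Complex.I)‖ ≤
      Real.exp (π * t - 58 / 100 * t) * π := by
  have hs : 0 < π / (4 * t) := by positivity
  set s := π / (4 * t) with hsdef
  have hre : ∀ y : ℝ, ((s : ℂ) + y * Complex.I).re = s := fun y ↦ by simp
  have him : ∀ y : ℝ, ((s : ℂ) + y * Complex.I).im = y := fun y ↦ by simp
  have hder : ∀ y : ℝ, HasDerivAt (fun y : ℝ ↦ pbarPrim n ((s : ℂ) + y * Complex.I))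
      (pbarGen (Complex.exp (-((s : ℂ) + y * Complex.I))) *
        Complex.exp (n * ((s : ℂ) + y * Complex.I)) * Complex.I) y := by
    intro y
    have h1 : HasDerivAt (fun w : ℂ ↦ (s : ℂ) + w * Complex.I) Complex.I (y : ℂ) := by
      simpa using ((hasDerivAt_id' (y : ℂ)).mul_const Complex.I).const_add (s : ℂ)
    have h2 := hasDerivAt_pbarPrim n (z := (s : ℂ) + y * Complex.I) (by rw [hre]; exact hs)
    exact (h2.comp (y : ℂ) h1).comp_ofReal
  have h := hK.norm_image_sub_le_of_norm_hasDerivWithin_le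
    (C := Real.exp (π * t - 58 / 100 * t)) (fun y _ ↦ (hder y).hasDerivWithinAt) (fun y hy ↦ ?_)
    ha hb
  · refine h.trans ?_
    rw [Real.norm_eq_abs]
    gcongr
  · have h1 := norm_integrand_vertical_le ht (z := (s : ℂ) + y * Complex.I) (hre y)
      (by rw [hre, him]; exact (hK1 y hy).1) (by rw [him]; exact (hK1 y hy).2)
    rw [norm_mul _ Complex.I, Complex.norm_I, mul_one]
    rw [hn] at h1
    exact_mod_cast h1

lemma pbarPrim_arc {n : ℕ} {t : ℝ} (ht : 1 ≤ t) (hn : t ^ 2 = n) :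
    |(pbarPrim n ((π / (2 * t) : ℝ) * Complex.exp ((π / 3 : ℝ) * Complex.I))).im -
      (pbarPrim n ((π / (2 * t) : ℝ) * Complex.exp ((-(π / 3) : ℝ) * Complex.I))).im -
      1 / 2 * √(1 / (2 * t)) * (π / (2 * t)) * Real.exp (π * t) *
        (saddlePrim (π * t) (1 / 2) - saddlePrim (π * t) (-(1 / 2)))| ≤
      1 / 2 * √(1 / (2 * t)) * (π / (2 * t)) * 2 * Real.exp (-(π * t)) * (2 * π / 3) := by
  have hpi := pi_pos
  have hder : ∀ θ ∈ Set.Icc (-(π / 3)) (π / 3), HasDerivAt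
      (fun θ : ℝ ↦ (pbarPrim n ((π / (2 * t) : ℝ) * Complex.exp (θ * Complex.I))).im -
        1 / 2 * √(1 / (2 * t)) * (π / (2 * t)) * Real.exp (π * t) *
          saddlePrim (π * t) (Real.sin (θ / 2)))
      ((pbarGen (Complex.exp (-((π / (2 * t) : ℝ) * Complex.exp (θ * Complex.I)))) *
        Complex.exp (n * ((π / (2 * t) : ℝ) * Complex.exp (θ * Complex.I))) *
        ((π / (2 * t) : ℝ) * (Complex.exp (θ * Complex.I) * Complex.I))).im -
        1 / 2 * √(1 / (2 * t)) * (π / (2 * t)) * Real.exp (π * t) *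
          (Real.cos (3 * θ / 2) * Real.exp (π * t * Real.cos θ - π * t))) θ := by
    intro θ hθ
    have hcos : 0 < Real.cos θ :=
      Real.cos_pos_of_mem_Ioo ⟨by linarith [hθ.1], by linarith [hθ.2]⟩
    have h1 : HasDerivAt (fun w : ℂ ↦ (π / (2 * t) : ℝ) * Complex.exp (w * Complex.I))
        ((π / (2 * t) : ℝ) * (Complex.exp (θ * Complex.I) * Complex.I)) (θ : ℂ) := by
      simpa using (((hasDerivAt_id' (θ : ℂ)).mul_const Complex.I).cexp).const_mul
        ((π / (2 * t) : ℝ) : ℂ)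
    have h2 := hasDerivAt_pbarPrim n
      (z := (π / (2 * t) : ℝ) * Complex.exp (θ * Complex.I)) (by
        rw [Complex.re_ofReal_mul, Complex.exp_ofReal_mul_I_re]
        positivity)
    have h3 := (h2.comp (θ : ℂ) h1).comp_ofReal
    have h4 := Complex.imCLM.hasFDerivAt.comp_hasDerivAt θ h3
    have h5 := (hasDerivAt_saddlePrim_sin (μ := π * t) (by positivity) θ).const_mul
      (1 / 2 * √(1 / (2 * t)) * (π / (2 * t)) * Real.exp (π * t))
    exact h4.sub h5
  have h := (convex_Icc (-(π / 3)) (π / 3)).norm_image_sub_le_of_norm_hasDerivWithin_le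
    (C := 1 / 2 * √(1 / (2 * t)) * (π / (2 * t)) * 2 * Real.exp (-(π * t)))
    (fun θ hθ ↦ (hder θ hθ).hasDerivWithinAt) (fun θ hθ ↦ ?_)
    (x := -(π / 3)) (y := π / 3) ⟨le_rfl, by linarith⟩ ⟨by linarith, le_rfl⟩
  · rw [Real.norm_eq_abs, Real.norm_eq_abs, show π / 3 - -(π / 3) = 2 * π / 3 by ring,
      abs_of_pos (show 0 < 2 * π / 3 by positivity),
      show π / 3 / 2 = π / 6 by ring, show -(π / 3) / 2 = -(π / 6) by ring, Real.sin_neg,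
      Real.sin_pi_div_six] at h
    convert h using 2
    ring
  · have h1 := integrand_arc ht (abs_le.mpr hθ)
    rw [hn] at h1
    refine le_trans ?_ (le_trans (Complex.abs_im_le_norm _) h1)
    rw [Real.norm_eq_abs]
    apply le_of_eq
    congr 1
    rw [Complex.sub_im, Complex.im_ofReal_mul, Complex.I_mul_im, Complex.exp_ofReal_mul_I_re,
      Real.exp_sub]
    push_cast
    field_simp

lemma saddle_rescale {t e : ℝ} (ht : t ≠ 0) (he : e ≠ 0) (p c : ℝ) :
    8 * t ^ 2 * e⁻¹ * p - (1 - c) =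
      4 * t ^ 2 / π * e⁻¹ * (2 * π * p - π / (4 * t ^ 2) * (1 - c) * e) := by
  field_simp
  ring

set_option maxHeartbeats 1000000 in
lemma abs_pbar_sub_le {n : ℕ} (hn : 5504 ≤ n) :
    |8 * n * Real.exp (-(π * √n)) * pbar n - (1 - 1 / (π * √n))| ≤ 100 / (n : ℝ) ^ 4 := by
  have ht : 74 ≤ √(n : ℝ) := by
    refine Real.le_sqrt_of_sq_le ?_
    have : (5504 : ℝ) ≤ n := by exact_mod_cast hn
    linarith
  have hsq : √(n : ℝ) ^ 2 = n := Real.sq_sqrt (Nat.cast_nonneg n)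
  set t := √(n : ℝ)
  have ht0 : 0 < t := by linarith
  have hpi3 := Real.pi_gt_three
  have hpi4 := Real.pi_lt_d4
  have hs : 0 < π / (4 * t) := by positivity
  have hs1 : π / (4 * t) ≤ 1 := by
    rw [div_le_one (by positivity)]
    linarith
  have harc := pbarPrim_arc (by linarith) hsq
  have hcau := pbarPrim_sub n hs
  have h3 : √3 ^ 2 = 3 := Real.sq_sqrt (by norm_num)
  have h30 : 0 ≤ √3 := Real.sqrt_nonneg _
  have hp1 : ((π / (2 * t) : ℝ) : ℂ) * Complex.exp ((π / 3 : ℝ) * Complex.I) =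
      (π / (4 * t) : ℝ) + ((√3 * (π / (4 * t)) : ℝ) : ℂ) * Complex.I := by
    rw [Complex.exp_mul_I, ← Complex.ofReal_cos, ← Complex.ofReal_sin, Real.cos_pi_div_three,
      Real.sin_pi_div_three]
    push_cast
    ring
  have hp2 : ((π / (2 * t) : ℝ) : ℂ) * Complex.exp ((-(π / 3) : ℝ) * Complex.I) =
      (π / (4 * t) : ℝ) + ((-(√3 * (π / (4 * t))) : ℝ) : ℂ) * Complex.I := by
    rw [Complex.exp_mul_I, ← Complex.ofReal_cos, ← Complex.ofReal_sin, Real.cos_neg,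
      Real.sin_neg, Real.cos_pi_div_three, Real.sin_pi_div_three]
    push_cast
    ring
  rw [hp1, hp2] at harc
  have hle : √3 * (π / (4 * t)) ≤ π := by nlinarith
  have hv1 := norm_pbarPrim_sub_vertical ht hsq (convex_Icc (√3 * (π / (4 * t))) π)
    (fun y hy ↦ ⟨by
      rw [← h3, ← mul_pow]
      exact pow_le_pow_left₀ (by positivity) hy.1 2, by
      rw [abs_of_nonneg (le_trans (by positivity) hy.1)]
      exact hy.2⟩)
    (a := √3 * (π / (4 * t))) (b := π) ⟨le_rfl, hle⟩ ⟨hle, le_rfl⟩ (by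
      rw [abs_of_nonneg (by linarith)]
      have : 0 ≤ √3 * (π / (4 * t)) := by positivity
      linarith)
  have hv2 := norm_pbarPrim_sub_vertical ht hsq (convex_Icc (-π) (-(√3 * (π / (4 * t)))))
    (fun y hy ↦ ⟨by
      rw [← h3, ← mul_pow, ← neg_sq y]
      exact pow_le_pow_left₀ (by positivity) (by linarith [hy.2]) 2, by
      rw [abs_of_nonpos (le_trans hy.2 (neg_nonpos.mpr (by positivity)))]
      linarith [hy.1]⟩)
    (a := -π) (b := -(√3 * (π / (4 * t)))) ⟨le_rfl, by linarith⟩ ⟨by linarith, le_rfl⟩ (by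
      have : 0 ≤ √3 * (π / (4 * t)) := by positivity
      rw [abs_of_nonneg (by linarith)]
      linarith)
  have hsad := saddlePrim_half (μ := π * t) (by nlinarith)
  rw [show π / (2 * (π * t)) = 1 / (2 * t) by field_simp] at hsad
  have hCsq : √(1 / (2 * t)) ^ 2 = 1 / (2 * t) := Real.sq_sqrt (by positivity)
  have hC0 : 0 ≤ √(1 / (2 * t)) := Real.sqrt_nonneg _
  have hC1 : √(1 / (2 * t)) ≤ 1 := by
    refine Real.sqrt_le_iff.mpr ⟨zero_le_one, ?_⟩
    rw [one_pow, div_le_one (by positivity)]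
    linarith
  have hC2 : π / (2 * t) ≤ 1 := by
    rw [div_le_one (by positivity)]
    linarith
  set G := pbarPrim n
  set A := G ((π / (4 * t) : ℝ) + ((√3 * (π / (4 * t)) : ℝ) : ℂ) * Complex.I)
  set B := G ((π / (4 * t) : ℝ) + ((-(√3 * (π / (4 * t))) : ℝ) : ℂ) * Complex.I)
  rw [Complex.ofReal_neg, neg_mul, ← sub_eq_add_neg] at hv2
  set P := G ((π / (4 * t) : ℝ) + (π : ℂ) * Complex.I)
  set M := G ((π / (4 * t) : ℝ) - (π : ℂ) * Complex.I)
  have himv1 := (Complex.abs_im_le_norm _).trans hv1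
  have himv2 := (Complex.abs_im_le_norm _).trans hv2
  have himc : P.im - M.im = 2 * π * pbar n := by
    rw [← Complex.sub_im, hcau]
    simp
  rw [Complex.sub_im] at himv1 himv2
  set Q := saddlePrim (π * t) (1 / 2) - saddlePrim (π * t) (-(1 / 2))
  have hE1 : Real.exp (-(π * t)) ≤ Real.exp (π * t - 58 / 100 * t) :=
    Real.exp_le_exp.mpr (by nlinarith)
  have hE2 : Real.exp (π * t) * Real.exp (-(π * t) / 2) ≤ Real.exp (π * t - 58 / 100 * t) := by
    rw [← Real.exp_add]
    exact Real.exp_le_exp.mpr (by nlinarith)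
  set E := Real.exp (π * t - 58 / 100 * t) with hEdef
  have hE : 0 < E := Real.exp_pos _
  set S := √(1 / (2 * t))
  have hmain : |1 / 2 * S * (π / (2 * t)) * Real.exp (π * t) * Q -
      π / (4 * t ^ 2) * (1 - 1 / (π * t)) * Real.exp (π * t)| ≤ E := by
    have : 1 / 2 * S * (π / (2 * t)) * Real.exp (π * t) * Q -
        π / (4 * t ^ 2) * (1 - 1 / (π * t)) * Real.exp (π * t) =
        1 / 2 * S * (π / (2 * t)) * Real.exp (π * t) * (Q - 2 * (1 - 1 / (π * t)) * S) := by
      have : π / (4 * t ^ 2) = S ^ 2 * (π / (2 * t)) := by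
        rw [hCsq]
        field_simp
        norm_num
      rw [this]
      ring
    rw [this, abs_mul, abs_of_nonneg (by positivity)]
    have h1 : 1 / 2 * S * (π / (2 * t)) ≤ 1 := by nlinarith
    calc _ ≤ 1 / 2 * S * (π / (2 * t)) * Real.exp (π * t) * Real.exp (-(π * t) / 2) := by gcongr
      _ = 1 / 2 * S * (π / (2 * t)) * (Real.exp (π * t) * Real.exp (-(π * t) / 2)) := by ring
      _ ≤ 1 * E := by gcongr
      _ = E := one_mul E
  have harc' : 1 / 2 * S * (π / (2 * t)) * 2 * Real.exp (-(π * t)) * (2 * π / 3) ≤ 3 * E := by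
    have h1 : 1 / 2 * S * (π / (2 * t)) * 2 ≤ 1 := by nlinarith
    calc 1 / 2 * S * (π / (2 * t)) * 2 * Real.exp (-(π * t)) * (2 * π / 3) ≤ 1 * E * 3 := by
          gcongr
          linarith
      _ = _ := by ring
  have hfin : |2 * π * pbar n - π / (4 * t ^ 2) * (1 - 1 / (π * t)) * Real.exp (π * t)| ≤
      12 * E := by
    have hEpi : E * π ≤ 4 * E := by nlinarith
    rw [abs_le] at himv1 himv2 harc hmain ⊢
    constructor <;> linarith [himv1.1, himv1.2, himv2.1, himv2.2, harc.1, harc.2, hmain.1, hmain.2]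
  have hdec := ten_pow_decay ht
  have hfactor : 8 * n * Real.exp (-(π * t)) * pbar n - (1 - 1 / (π * t)) =
      4 * t ^ 2 / π * Real.exp (-(π * t)) *
        (2 * π * pbar n - π / (4 * t ^ 2) * (1 - 1 / (π * t)) * Real.exp (π * t)) := by
    rw [← hsq, Real.exp_neg]
    exact saddle_rescale ht0.ne' (Real.exp_pos _).ne' _ _
  rw [hfactor, abs_mul, abs_of_nonneg (by positivity)]
  calc _ ≤ 4 * t ^ 2 / π * Real.exp (-(π * t)) * (12 * E) := by gcongr
    _ = 48 / π * t ^ 2 * (Real.exp (-(π * t)) * E) := by ring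
    _ = 48 / π * t ^ 2 * Real.exp (-(58 / 100 * t)) := by
      rw [hEdef, ← Real.exp_add]
      ring_nf
    _ ≤ 16 * t ^ 2 * Real.exp (-(58 / 100 * t)) := by
      gcongr
      rw [div_le_iff₀ pi_pos]
      linarith
    _ ≤ _ := by
      rw [← hsq, ← pow_mul]
      exact hdec

/-! ### Expansion of `log r_α` -/

lemma abs_log_sub_log_le {a b δ : ℝ} (ha : 2 / 3 ≤ a) (hb : 2 / 3 ≤ b) (h : |a - b| ≤ δ) :
    |Real.log a - Real.log b| ≤ 2 * δ := by
  have ha0 : 0 < a := by linarith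
  have hb0 : 0 < b := by linarith
  rw [abs_le] at h ⊢
  have h1 := Real.log_le_sub_one_of_pos (div_pos ha0 hb0)
  have h2 := Real.log_le_sub_one_of_pos (div_pos hb0 ha0)
  rw [Real.log_div ha0.ne' hb0.ne', div_sub_one hb0.ne'] at h1
  rw [Real.log_div hb0.ne' ha0.ne', div_sub_one ha0.ne'] at h2
  have h3 : (a - b) / b ≤ 2 * δ := by
    rw [div_le_iff₀ hb0]
    nlinarith
  have h4 : (b - a) / a ≤ 2 * δ := by
    rw [div_le_iff₀ ha0]
    nlinarith
  constructor <;> linarith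

/-- The truncated expansion of `log (1 - w / π)`. -/
noncomputable def logPoly (w : ℝ) : ℝ :=
  w / π + w ^ 2 / (2 * π ^ 2) + w ^ 3 / (3 * π ^ 3) + w ^ 4 / (4 * π ^ 4) + w ^ 5 / (5 * π ^ 5) +
    w ^ 6 / (6 * π ^ 6) + w ^ 7 / (7 * π ^ 7)

lemma abs_log_one_sub_add_logPoly_le {w : ℝ} (h0 : 0 ≤ w) (h1 : w ≤ 1 / 50) :
    |Real.log (1 - w / π) + logPoly w| ≤ w ^ 8 := by
  have hpi := Real.pi_gt_three
  have hs0 : 0 ≤ w / π := by positivity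
  have hs1 : w / π ≤ w / 3 := by gcongr
  have h := Real.abs_log_sub_add_sum_range_le (x := w / π)
    (by rw [abs_of_nonneg hs0]; linarith) 7
  rw [abs_of_nonneg hs0] at h
  have hsum : ∑ i ∈ Finset.range 7, (w / π) ^ (i + 1) / ((i : ℝ) + 1) = logPoly w := by
    simp only [Finset.sum_range_succ, Finset.sum_range_zero, logPoly]
    push_cast
    field_simp
    ring
  rw [hsum, add_comm] at h
  refine h.trans ?_
  rw [div_le_iff₀ (by linarith)]
  have h8 : (w / π) ^ 8 ≤ (w / 3) ^ 8 := pow_le_pow_left₀ hs0 hs1 8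
  have : (w / 3) ^ 8 = w ^ 8 / 6561 := by ring
  have hw8 : 0 ≤ w ^ 8 := by positivity
  norm_num at h8 ⊢
  nlinarith

lemma rseq_pos_and_log {α : ℝ} {k : ℕ} (hk : 5504 ≤ k) :
    0 < rseq α k ∧ |Real.log (rseq α k) - (π * (1 / √k) -
      (Real.log 8 + (1 + α) * Real.log k) * (1 / √k) ^ 2 - (1 / √k) ^ 2 * logPoly (1 / √k))| ≤
        201 * (1 / √(k : ℝ)) ^ 10 := by
  have hkr : (5504 : ℝ) ≤ k := by exact_mod_cast hk
  have hk0 : (0 : ℝ) < k := by linarith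
  have ht : 74 ≤ √(k : ℝ) := Real.le_sqrt_of_sq_le (by linarith)
  have hsq : √(k : ℝ) ^ 2 = k := Real.sq_sqrt hk0.le
  have hmain := abs_pbar_sub_le hk
  set t := √(k : ℝ)
  have hpi := Real.pi_gt_three
  have hw0 : 0 < 1 / t := by positivity
  have hw1 : 1 / t ≤ 1 / 74 := one_div_le_one_div_of_le (by norm_num) ht
  have hwpi : 1 / t / π ≤ 1 / t / 1 := by gcongr; linarith
  have hlog := abs_log_one_sub_add_logPoly_le hw0.le (by linarith)
  have hk4 : (100 : ℝ) / k ^ 4 ≤ 1 / 100 := by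
    rw [div_le_div_iff₀ (by positivity) (by norm_num)]
    have : (5504 : ℝ) ^ 4 ≤ (k : ℝ) ^ 4 := by gcongr
    linarith
  rw [show 1 / (π * t) = 1 / t / π by field_simp] at hmain
  have hkw : (1 : ℝ) / k = (1 / t) ^ 2 := by rw [← hsq]; field_simp
  have hk4w : (100 : ℝ) / k ^ 4 = 100 * (1 / t) ^ 8 := by rw [← hsq]; field_simp
  set w := 1 / t
  have hY : 2 / 3 ≤ 8 * k * Real.exp (-(π * t)) * pbar k := by
    have := (abs_le.mp hmain).1
    linarith
  have hp : 0 < (pbar k : ℝ) := by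
    by_contra h
    have h0 : (pbar k : ℝ) = 0 := le_antisymm (not_lt.mp h) (Nat.cast_nonneg _)
    rw [h0] at hY
    norm_num at hY
  have hll := abs_log_sub_log_le hY (by linarith) hmain
  have hlogY : Real.log (8 * k * Real.exp (-(π * t)) * pbar k) =
      Real.log 8 + Real.log k - π * t + Real.log (pbar k) := by
    rw [Real.log_mul (by positivity) hp.ne', Real.log_mul (by positivity) (Real.exp_pos _).ne',
      Real.log_mul (by norm_num) hk0.ne', Real.log_exp]
    ring
  have hbase : 0 < (pbar k : ℝ) / (k : ℝ) ^ α := by positivity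
  have hr : 0 < rseq α k := Real.rpow_pos_of_pos hbase _
  refine ⟨hr, ?_⟩
  have hlogr : Real.log (rseq α k) = w ^ 2 * (Real.log (pbar k) - α * Real.log k) := by
    rw [rseq, Real.log_rpow hbase, Real.log_div hp.ne' (by positivity), Real.log_rpow hk0, ← hkw,
      one_div]
  have hwt : π * w = w ^ 2 * (π * t) := by
    have : w * t = 1 := by simp only [w]; field_simp
    linear_combination (-(π * w)) * this
  rw [hlogr, hwt]
  rw [hlogY, hk4w] at hll
  have key : |Real.log 8 + Real.log k - π * t + Real.log (pbar k) + logPoly w| ≤ 201 * w ^ 8 := by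
    rw [abs_le] at hll hlog ⊢
    constructor <;> linarith [hll.1, hll.2, hlog.1, hlog.2]
  calc _ = |w ^ 2 * (Real.log 8 + Real.log k - π * t + Real.log (pbar k) + logPoly w)| := by
        congr 1
        ring
    _ = w ^ 2 * |Real.log 8 + Real.log k - π * t + Real.log (pbar k) + logPoly w| := by
        rw [abs_mul, abs_of_nonneg (by positivity)]
    _ ≤ w ^ 2 * (201 * w ^ 8) := by gcongr
    _ = _ := by ring

/-! ### Binomial expansions -/

lemma abs_sub_le_of_sq_mul {c P w ε : ℝ} (hc : 0 ≤ c) (h : c ^ 2 * w = 1) (hw : 1 / 2 ≤ w)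
    (hP : 1 / 2 ≤ P) (hε : |1 - P ^ 2 * w| ≤ ε) : |c - P| ≤ 4 * ε := by
  have h1 : (c - P) * ((c + P) * w) = 1 - P ^ 2 * w := by linear_combination h
  have h2 : 1 / 4 ≤ (c + P) * w := by nlinarith
  rw [← h1, abs_mul, abs_of_nonneg (by linarith : 0 ≤ (c + P) * w)] at hε
  nlinarith [abs_nonneg (c - P)]

lemma abs_pow_sub_le {a h P q : ℝ} {m r : ℕ} (hm : m ≤ 9) (ha : 0 ≤ a) (h1 : a ^ 2 * (1 + h) = 1)
    (hh : |h| ≤ 1 / 1000) (hP : 1 / 2 ≤ P) (hq : 1 - P ^ 2 * (1 + h) ^ m = h ^ r * q)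
    (hq' : |q| ≤ 20) : |a ^ m - P| ≤ 80 * |h| ^ r := by
  have hh' := abs_le.mp hh
  have hw : 1 / 2 ≤ (1 + h) ^ m :=
    calc (1 / 2 : ℝ) ≤ (999 / 1000) ^ 9 := by norm_num
      _ ≤ (999 / 1000) ^ m := pow_le_pow_of_le_one (by norm_num) (by norm_num) hm
      _ ≤ (1 + h) ^ m := pow_le_pow_left₀ (by norm_num) (by linarith) m
  have hsq : (a ^ m) ^ 2 * (1 + h) ^ m = 1 := by
    rw [← pow_mul, mul_comm m 2, pow_mul, ← mul_pow, h1, one_pow]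
  have := abs_sub_le_of_sq_mul (pow_nonneg ha m) hsq hw hP (ε := 20 * |h| ^ r) (by
    rw [hq, abs_mul, abs_pow, mul_comm]
    gcongr)
  linarith

/-- Binomial expansions of the powers of `a = (1 + h) ^ (-1 / 2)`. -/
lemma inv_sqrt_pow_bounds {a h : ℝ} (ha : 0 ≤ a) (h1 : a ^ 2 * (1 + h) = 1)
    (hh : |h| ≤ 1 / 1000) :
    |a ^ 1 - (1 - 1 / 2 * h + 3 / 8 * h ^ 2 - 5 / 16 * h ^ 3 + 35 / 128 * h ^ 4)| ≤ 80 * |h| ^ 5 ∧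
    |a ^ 2 - (1 - h + h ^ 2 - h ^ 3)| ≤ 80 * |h| ^ 4 ∧
    |a ^ 3 - (1 - 3 / 2 * h + 15 / 8 * h ^ 2 - 35 / 16 * h ^ 3)| ≤ 80 * |h| ^ 4 ∧
    |a ^ 4 - (1 - 2 * h + 3 * h ^ 2)| ≤ 80 * |h| ^ 3 ∧
    |a ^ 5 - (1 - 5 / 2 * h + 35 / 8 * h ^ 2)| ≤ 80 * |h| ^ 3 ∧
    |a ^ 6 - (1 - 3 * h)| ≤ 80 * |h| ^ 2 ∧
    |a ^ 7 - (1 - 7 / 2 * h)| ≤ 80 * |h| ^ 2 ∧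
    |a ^ 8 - 1| ≤ 80 * |h| ∧
    |a ^ 9 - 1| ≤ 80 * |h| := by
  have hb : ∀ j : ℕ, -(1 / 1000) ^ j ≤ h ^ j ∧ h ^ j ≤ (1 / 1000) ^ j := fun j ↦ by
    rw [← abs_le, abs_pow]
    exact pow_le_pow_left₀ (abs_nonneg h) hh j
  have b1 := hb 1
  have b2 := hb 2
  have b3 := hb 3
  have b4 := hb 4
  have b5 := hb 5
  have b6 := hb 6
  have b7 := hb 7
  have b8 := hb 8
  norm_num at b1 b2 b3 b4 b5 b6 b7 b8
  refine ⟨?_, ?_, ?_, ?_, ?_, ?_, ?_, ?_, ?_⟩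
  · exact abs_pow_sub_le (m := 1) (r := 5) (P := 1 - 1 / 2 * h + 3 / 8 * h ^ 2 -
      5 / 16 * h ^ 3 + 35 / 128 * h ^ 4)
      (q := -63 / 128 + 105 / 512 * h - 135 / 1024 * h ^ 2 + 1575 / 16384 * h ^ 3 -
          1225 / 16384 * h ^ 4)
      (by norm_num) ha h1 hh (by linarith) (by ring) (by rw [abs_le]; constructor <;> linarith)
  · exact abs_pow_sub_le (m := 2) (r := 4) (P := 1 - h + h ^ 2 - h ^ 3)
      (q := 2 - h ^ 4)
      (by norm_num) ha h1 hh (by linarith) (by ring) (by rw [abs_le]; constructor <;> linarith)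
  · exact abs_pow_sub_le (m := 3) (r := 4) (P := 1 - 3 / 2 * h + 15 / 8 * h ^ 2 - 35 / 16 * h ^ 3)
      (q := 315 / 64 + 63 / 32 * h - 105 / 256 * h ^ 2 + 45 / 256 * h ^ 3 - 1575 / 256 * h ^ 4 -
          1225 / 256 * h ^ 5)
      (by norm_num) ha h1 hh (by linarith) (by ring) (by rw [abs_le]; constructor <;> linarith)
  · exact abs_pow_sub_le (m := 4) (r := 3) (P := 1 - 2 * h + 3 * h ^ 2)
      (q := -8 - 6 * h - 16 * h ^ 3 - 24 * h ^ 4 - 9 * h ^ 5)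
      (by norm_num) ha h1 hh (by linarith) (by ring) (by rw [abs_le]; constructor <;> linarith)
  · exact abs_pow_sub_le (m := 5) (r := 3) (P := 1 - 5 / 2 * h + 35 / 8 * h ^ 2)
      (q := -105 / 8 - 945 / 64 * h - 189 / 64 * h ^ 2 - 1365 / 32 * h ^ 3 - 3105 / 32 * h ^ 4 -
          4725 / 64 * h ^ 5 - 1225 / 64 * h ^ 6)
      (by norm_num) ha h1 hh (by linarith) (by ring) (by rw [abs_le]; constructor <;> linarith)
  · exact abs_pow_sub_le (m := 6) (r := 2) (P := 1 - 3 * h)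
      (q := 12 + 16 * h - 30 * h ^ 2 - 96 * h ^ 3 - 100 * h ^ 4 - 48 * h ^ 5 - 9 * h ^ 6)
      (by norm_num) ha h1 hh (by linarith) (by ring) (by rw [abs_le]; constructor <;> linarith)
  · exact abs_pow_sub_le (m := 7) (r := 2) (P := 1 - 7 / 2 * h)
      (q := 63 / 4 + 105 / 4 * h - 189 / 4 * h ^ 2 - 819 / 4 * h ^ 3 - 1155 / 4 * h ^ 4 -
          837 / 4 * h ^ 5 - 315 / 4 * h ^ 6 - 49 / 4 * h ^ 7)
      (by norm_num) ha h1 hh (by linarith) (by ring) (by rw [abs_le]; constructor <;> linarith)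
  · have := abs_pow_sub_le (m := 8) (r := 1) (P := 1)
      (q := -8 - 28 * h - 56 * h ^ 2 - 70 * h ^ 3 - 56 * h ^ 4 - 28 * h ^ 5 - 8 * h ^ 6 - h ^ 7)
      (by norm_num) ha h1 hh (by linarith) (by ring) (by rw [abs_le]; constructor <;> linarith)
    simpa using this
  · have := abs_pow_sub_le (m := 9) (r := 1) (P := 1)
      (q := -9 - 36 * h - 84 * h ^ 2 - 126 * h ^ 3 - 126 * h ^ 4 - 84 * h ^ 5 - 36 * h ^ 6 -
          9 * h ^ 7 - h ^ 8)
      (by norm_num) ha h1 hh (by linarith) (by ring) (by rw [abs_le]; constructor <;> linarith)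
    simpa using this

lemma log_one_add_mul_bound {a h : ℝ} (h1 : a ^ 2 * (1 + h) = 1) (hh : |h| ≤ 1 / 1000) :
    |Real.log (1 + h) * a ^ 2 - (h - 3 / 2 * h ^ 2 + 11 / 6 * h ^ 3)| ≤ 4 * h ^ 4 := by
  have hh' := abs_le.mp hh
  have hlog := Real.abs_log_sub_add_sum_range_le (x := -h) (by rw [abs_neg]; linarith) 3
  simp only [Finset.sum_range_succ, Finset.sum_range_zero] at hlog
  norm_num at hlog
  have h4 : |h| ^ 4 = h ^ 4 := by rw [← abs_pow]; exact abs_of_nonneg (by positivity)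
  rw [h4] at hlog
  have h40 : 0 ≤ h ^ 4 := by positivity
  have hlog2 : h ^ 4 / (1 - |h|) ≤ 101 / 100 * h ^ 4 := by
    rw [div_le_iff₀ (by linarith)]
    nlinarith
  have ha2 : 0 ≤ a ^ 2 := sq_nonneg a
  have ha2' : a ^ 2 ≤ 101 / 100 := by nlinarith
  have key : Real.log (1 + h) * a ^ 2 - (h - 3 / 2 * h ^ 2 + 11 / 6 * h ^ 3) =
      (Real.log (1 + h) - (h - h ^ 2 / 2 + h ^ 3 / 3) - 11 / 6 * h ^ 4) * a ^ 2 := by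
    linear_combination (h - 3 / 2 * h ^ 2 + 11 / 6 * h ^ 3) * h1
  rw [key, abs_mul, abs_of_nonneg ha2]
  have hb : |Real.log (1 + h) - (h - h ^ 2 / 2 + h ^ 3 / 3) - 11 / 6 * h ^ 4| ≤ 3 * h ^ 4 := by
    have := hlog.trans hlog2
    rw [abs_le] at this ⊢
    constructor <;> linarith [this.1, this.2]
  calc _ ≤ 3 * h ^ 4 * (101 / 100) := by gcongr
    _ ≤ _ := by linarith

set_option maxHeartbeats 800000 in
lemma symm_pow_bounds {a b v : ℝ} (ha : 0 ≤ a) (hb : 0 ≤ b) (h1 : a ^ 2 * (1 + v ^ 2) = 1)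
    (h2 : b ^ 2 * (1 - v ^ 2) = 1) (hv : v ^ 2 ≤ 1 / 1000) :
    |a + b - 2 - (3 / 4 * v ^ 4 + 35 / 64 * v ^ 8)| ≤ 160 * v ^ 10 ∧
    (2 * v ^ 4 ≤ a ^ 2 + b ^ 2 - 2 ∧ a ^ 2 + b ^ 2 - 2 ≤ 2 * v ^ 4 + 160 * v ^ 8) ∧
    |a ^ 3 + b ^ 3 - 2 - 15 / 4 * v ^ 4| ≤ 160 * v ^ 8 ∧
    |a ^ 4 + b ^ 4 - 2 - 6 * v ^ 4| ≤ 160 * v ^ 6 ∧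
    |a ^ 5 + b ^ 5 - 2 - 35 / 4 * v ^ 4| ≤ 160 * v ^ 6 ∧
    |a ^ 6 + b ^ 6 - 2| ≤ 160 * v ^ 4 ∧
    |a ^ 7 + b ^ 7 - 2| ≤ 160 * v ^ 4 ∧
    |a ^ 8 + b ^ 8 - 2| ≤ 160 * v ^ 2 ∧
    |a ^ 9 + b ^ 9 - 2| ≤ 160 * v ^ 2 ∧
    a ^ 10 + b ^ 10 + 2 ≤ 41 / 10 ∧
    |Real.log (1 + v ^ 2) * a ^ 2 + Real.log (1 - v ^ 2) * b ^ 2 + 3 * v ^ 4| ≤ 8 * v ^ 8 := by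
  have hv0 : 0 ≤ v ^ 2 := sq_nonneg v
  have hab : |v ^ 2| = v ^ 2 := abs_of_nonneg hv0
  have hn1 : |v ^ 2| ≤ 1 / 1000 := by rwa [hab]
  have hn2 : |-v ^ 2| ≤ 1 / 1000 := by rwa [abs_neg]
  have h2' : b ^ 2 * (1 + -v ^ 2) = 1 := by rwa [← sub_eq_add_neg]
  obtain ⟨p1, p2, p3, p4, p5, p6, p7, p8, p9⟩ := inv_sqrt_pow_bounds ha h1 hn1
  obtain ⟨q1, q2, q3, q4, q5, q6, q7, q8, q9⟩ := inv_sqrt_pow_bounds hb h2' hn2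
  have l1 := log_one_add_mul_bound h1 hn1
  have l2 := log_one_add_mul_bound h2' hn2
  rw [← sub_eq_add_neg] at l2
  simp only [abs_neg, hab] at p1 p2 p3 p4 p5 p6 p7 p8 p9 q1 q2 q3 q4 q5 q6 q7 q8 q9
  have ha2 : a ^ 2 ≤ 1 := by nlinarith [sq_nonneg a]
  have hb2 : b ^ 2 ≤ 1002 / 1000 := by nlinarith [sq_nonneg b]
  have ha10 : a ^ 10 ≤ (102 / 100) := by
    calc a ^ 10 = (a ^ 2) ^ 5 := by ring
      _ ≤ 1 ^ 5 := pow_le_pow_left₀ (sq_nonneg a) ha2 5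
      _ ≤ _ := by norm_num
  have hb10 : b ^ 10 ≤ (102 / 100) := by
    calc b ^ 10 = (b ^ 2) ^ 5 := by ring
      _ ≤ (1002 / 1000) ^ 5 := pow_le_pow_left₀ (sq_nonneg b) hb2 5
      _ ≤ _ := by norm_num
  simp only [abs_le] at p1 p2 p3 p4 p5 p6 p7 p8 p9 q1 q2 q3 q4 q5 q6 q7 q8 q9 l1 l2 ⊢
  have hS2 : 2 * v ^ 4 ≤ a ^ 2 + b ^ 2 - 2 := by
    have e : a ^ 2 * b ^ 2 * (1 - v ^ 4) = 1 := by
      linear_combination b ^ 2 * (1 - v ^ 2) * h1 + h2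
    have e1 : a ^ 2 + b ^ 2 = 2 * (a ^ 2 * b ^ 2) := by
      linear_combination (-b ^ 2) * h1 - a ^ 2 * h2
    have e2 : 0 ≤ a ^ 2 * b ^ 2 * v ^ 8 := by positivity
    have e3 : a ^ 2 * b ^ 2 = 1 + v ^ 4 + a ^ 2 * b ^ 2 * v ^ 8 := by
      linear_combination (1 + v ^ 4) * e
    linarith
  ring_nf at p1 p2 p3 p4 p5 p6 p7 p8 p9 q1 q2 q3 q4 q5 q6 q7 q8 q9 l1 l2
  refine ⟨⟨?_, ?_⟩, ⟨hS2, ?_⟩, ⟨?_, ?_⟩, ⟨?_, ?_⟩, ⟨?_, ?_⟩, ⟨?_, ?_⟩, ⟨?_, ?_⟩, ⟨?_, ?_⟩,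
    ⟨?_, ?_⟩, by linarith, ?_, ?_⟩
  · linarith only [p1.1, q1.1]
  · linarith only [p1.2, q1.2]
  · linarith only [p2.2, q2.2]
  · linarith only [p3.1, q3.1]
  · linarith only [p3.2, q3.2]
  · linarith only [p4.1, q4.1]
  · linarith only [p4.2, q4.2]
  · linarith only [p5.1, q5.1]
  · linarith only [p5.2, q5.2]
  · linarith only [p6.1, q6.1]
  · linarith only [p6.2, q6.2]
  · linarith only [p7.1, q7.1]
  · linarith only [p7.2, q7.2]
  · linarith only [p8.1, q8.1]
  · linarith only [p8.2, q8.2]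
  · linarith only [p9.1, q9.1]
  · linarith only [p9.2, q9.2]
  · linarith only [l1.1, l2.1]
  · linarith only [l1.2, l2.2]

/-- The main terms of the expansion of `log (useq α n)`, with `v = n ^ (-1 / 2)`, `l = log n`. -/
noncomputable def logMain (α v l : ℝ) : ℝ :=
  3 * π / 4 * v ^ 5 - 2 * Real.log 8 * v ^ 6 - (1 + α) * (2 * l - 3) * v ^ 6 -
    15 / (4 * π) * v ^ 7 - 3 / π ^ 2 * v ^ 8 + 35 * (-16 + 3 * π ^ 4) / (192 * π ^ 3) * v ^ 9

lemma log_eight_bounds : 2 ≤ Real.log 8 ∧ Real.log 8 ≤ 21 / 10 := by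
  have : Real.log 8 = 3 * Real.log 2 := by
    rw [show (8 : ℝ) = 2 ^ (3 : ℕ) by norm_num, Real.log_pow]
    norm_num
  constructor <;> linarith [Real.log_two_gt_d9, Real.log_two_lt_d9]

lemma abs_mul_le_of_abs_le {c x e d : ℝ} (hc0 : 0 ≤ c) (hc : c ≤ d) (hx : |x| ≤ e) :
    |c * x| ≤ d * e := by
  rw [abs_mul, abs_of_nonneg hc0]
  exact mul_le_mul hc hx (abs_nonneg _) (hc0.trans hc)

lemma logPoly_second_difference {a b v : ℝ} (ha : 0 ≤ a) (hb : 0 ≤ b) (hv0 : 0 ≤ v)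
    (hv : v ≤ 1 / 74) (h1 : a ^ 2 * (1 + v ^ 2) = 1) (h2 : b ^ 2 * (1 - v ^ 2) = 1) :
    |(v * a) ^ 2 * logPoly (v * a) + (v * b) ^ 2 * logPoly (v * b) - 2 * (v ^ 2 * logPoly v) -
      (15 / (4 * π) * v ^ 7 + 3 / π ^ 2 * v ^ 8 + 35 / (12 * π ^ 3) * v ^ 9)| ≤ 60 * v ^ 10 := by
  have hv2 : v ^ 2 ≤ 1 / 1000 := by nlinarith
  obtain ⟨-, -, s3, s4, s5, s6, s7, s8, s9, -, -⟩ := symm_pow_bounds ha hb h1 h2 hv2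
  have hpi := Real.pi_gt_three
  have hc : ∀ j i : ℕ, 0 < j → 0 ≤ v ^ i / (j * π ^ j) ∧ v ^ i / (j * π ^ j) ≤ v ^ i / j := by
    intro j i hj
    refine ⟨by positivity, ?_⟩
    have : (1 : ℝ) ≤ π ^ j := one_le_pow₀ (by linarith)
    have hj' : (0 : ℝ) < j := by exact_mod_cast hj
    gcongr
    nlinarith
  have t3 := abs_mul_le_of_abs_le (hc 1 3 (by norm_num)).1 (hc 1 3 (by norm_num)).2 s3
  have t4 := abs_mul_le_of_abs_le (c := v ^ 4 / (2 * π ^ 2)) (d := v ^ 4 / 18) (by positivity)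
    (by gcongr; nlinarith) s4
  have t5 := abs_mul_le_of_abs_le (c := v ^ 5 / (3 * π ^ 3)) (d := v ^ 5 / 1) (by positivity)
    (by gcongr; nlinarith [one_le_pow₀ (n := 3) (show 1 ≤ π by linarith)]) s5
  have t6 := abs_mul_le_of_abs_le (c := v ^ 6 / (4 * π ^ 4)) (d := v ^ 6 / 36) (by positivity)
    (by gcongr; nlinarith [pow_le_pow_left₀ (by norm_num) hpi.le 4]) s6
  have t7 := abs_mul_le_of_abs_le (c := v ^ 7 / (5 * π ^ 5)) (d := v ^ 7 / 1) (by positivity)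
    (by gcongr; nlinarith [one_le_pow₀ (n := 5) (show 1 ≤ π by linarith)]) s7
  have t8 := abs_mul_le_of_abs_le (c := v ^ 8 / (6 * π ^ 6)) (d := v ^ 8 / 36) (by positivity)
    (by gcongr; nlinarith [pow_le_pow_left₀ (by norm_num) hpi.le 6]) s8
  have t9 := abs_mul_le_of_abs_le (c := v ^ 9 / (7 * π ^ 7)) (d := v ^ 9 / 1) (by positivity)
    (by gcongr; nlinarith [one_le_pow₀ (n := 7) (show 1 ≤ π by linarith)]) s9
  push_cast at t3
  have hv11 : v ^ 11 ≤ 1 / 74 * v ^ 10 := by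
    rw [pow_succ' v 10]
    exact mul_le_mul_of_nonneg_right hv (by positivity)
  have hkey : (v * a) ^ 2 * logPoly (v * a) + (v * b) ^ 2 * logPoly (v * b) -
      2 * (v ^ 2 * logPoly v) -
      (15 / (4 * π) * v ^ 7 + 3 / π ^ 2 * v ^ 8 + 35 / (12 * π ^ 3) * v ^ 9) =
      v ^ 3 / (1 * π ^ 1) * (a ^ 3 + b ^ 3 - 2 - 15 / 4 * v ^ 4) +
      v ^ 4 / (2 * π ^ 2) * (a ^ 4 + b ^ 4 - 2 - 6 * v ^ 4) +
      v ^ 5 / (3 * π ^ 3) * (a ^ 5 + b ^ 5 - 2 - 35 / 4 * v ^ 4) +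
      v ^ 6 / (4 * π ^ 4) * (a ^ 6 + b ^ 6 - 2) + v ^ 7 / (5 * π ^ 5) * (a ^ 7 + b ^ 7 - 2) +
      v ^ 8 / (6 * π ^ 6) * (a ^ 8 + b ^ 8 - 2) + v ^ 9 / (7 * π ^ 7) * (a ^ 9 + b ^ 9 - 2) := by
    simp only [logPoly, mul_pow]
    field_simp
    ring
  rw [hkey]
  have e3 : v ^ 3 / 1 * (160 * v ^ 8) = 160 * v ^ 11 := by ring
  have e4 : v ^ 4 / 18 * (160 * v ^ 6) = 80 / 9 * v ^ 10 := by ring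
  have e5 : v ^ 5 / 1 * (160 * v ^ 6) = 160 * v ^ 11 := by ring
  have e6 : v ^ 6 / 36 * (160 * v ^ 4) = 40 / 9 * v ^ 10 := by ring
  have e7 : v ^ 7 / 1 * (160 * v ^ 4) = 160 * v ^ 11 := by ring
  have e8 : v ^ 8 / 36 * (160 * v ^ 2) = 40 / 9 * v ^ 10 := by ring
  have e9 : v ^ 9 / 1 * (160 * v ^ 2) = 160 * v ^ 11 := by ring
  rw [e3] at t3
  rw [e4] at t4
  rw [e5] at t5
  rw [e6] at t6
  rw [e7] at t7
  rw [e8] at t8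
  rw [e9] at t9
  rw [abs_le] at t3 t4 t5 t6 t7 t8 t9 ⊢
  constructor <;> linarith [t3.1, t4.1, t5.1, t6.1, t7.1, t8.1, t9.1, t3.2, t4.2, t5.2, t6.2,
    t7.2, t8.2, t9.2]

lemma second_difference_bounds {α a b v l r₁ r₂ r₀ : ℝ} (hα : 0 ≤ α) (hl : 0 ≤ l) (ha : 0 ≤ a)
    (hb : 0 ≤ b) (hv0 : 0 ≤ v) (hv : v ≤ 1 / 74) (h1 : a ^ 2 * (1 + v ^ 2) = 1)
    (h2 : b ^ 2 * (1 - v ^ 2) = 1)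
    (hr₁ : |r₁ - (π * (v * a) - (Real.log 8 + (1 + α) * (l + Real.log (1 + v ^ 2))) * (v * a) ^ 2 -
      (v * a) ^ 2 * logPoly (v * a))| ≤ 201 * (v * a) ^ 10)
    (hr₂ : |r₂ - (π * (v * b) - (Real.log 8 + (1 + α) * (l + Real.log (1 - v ^ 2))) * (v * b) ^ 2 -
      (v * b) ^ 2 * logPoly (v * b))| ≤ 201 * (v * b) ^ 10)
    (hr₀ : |r₀ - (π * v - (Real.log 8 + (1 + α) * l) * v ^ 2 - v ^ 2 * logPoly v)| ≤
      201 * v ^ 10) :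
    -(2000 * (1 + α) * (1 + l) * v ^ 10) ≤ r₁ + r₂ - 2 * r₀ - logMain α v l ∧
      r₁ + r₂ - 2 * r₀ - logMain α v l ≤ 2000 * (1 + α) * v ^ 10 := by
  have hv2 : v ^ 2 ≤ 1 / 1000 := by nlinarith
  have hlp := logPoly_second_difference ha hb hv0 hv h1 h2
  obtain ⟨s1, s2, -, -, -, -, -, -, -, s10, sl⟩ := symm_pow_bounds ha hb h1 h2 hv2
  obtain ⟨h8, h8'⟩ := log_eight_bounds
  have hpi := Real.pi_lt_d2
  have hv10 : 0 ≤ v ^ 10 := by positivity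
  have t1 := abs_mul_le_of_abs_le (c := π * v) (d := 315 / 100 * (1 / 74)) (by positivity)
    (by gcongr; linarith) s1
  have s2' : |a ^ 2 + b ^ 2 - 2 - 2 * v ^ 4| ≤ 160 * v ^ 8 := by
    rw [abs_le]
    have : 0 ≤ v ^ 8 := by positivity
    constructor <;> linarith [s2.1, s2.2]
  have t2 := abs_mul_le_of_abs_le (c := Real.log 8 * v ^ 2) (d := 21 / 10 * v ^ 2) (by positivity)
    (by gcongr) s2'
  have t3 := abs_mul_le_of_abs_le (c := (1 + α) * v ^ 2) (by positivity) le_rfl sl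
  have t3' : 0 ≤ (1 + α) * l * v ^ 2 * (a ^ 2 + b ^ 2 - 2 - 2 * v ^ 4) :=
    mul_nonneg (by positivity) (by linarith [s2.1])
  have t3'' : (1 + α) * l * v ^ 2 * (a ^ 2 + b ^ 2 - 2 - 2 * v ^ 4) ≤
      (1 + α) * l * v ^ 2 * (160 * v ^ 8) := by
    gcongr
    linarith [s2.2]
  have t10 : 201 * (v * a) ^ 10 + 201 * (v * b) ^ 10 + 2 * (201 * v ^ 10) ≤ 825 * v ^ 10 := by
    have := mul_le_mul_of_nonneg_left s10 hv10
    simp only [mul_pow]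
    linarith
  have hmain : 35 * (-16 + 3 * π ^ 4) / (192 * π ^ 3) = 35 * π / 64 - 35 / (12 * π ^ 3) := by
    field_simp
    ring
  set A := r₁ - (π * (v * a) - (Real.log 8 + (1 + α) * (l + Real.log (1 + v ^ 2))) * (v * a) ^ 2 -
      (v * a) ^ 2 * logPoly (v * a)) with hA
  set B := r₂ - (π * (v * b) - (Real.log 8 + (1 + α) * (l + Real.log (1 - v ^ 2))) * (v * b) ^ 2 -
      (v * b) ^ 2 * logPoly (v * b)) with hB
  set C := r₀ - (π * v - (Real.log 8 + (1 + α) * l) * v ^ 2 - v ^ 2 * logPoly v) with hC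
  set P := (v * a) ^ 2 * logPoly (v * a) + (v * b) ^ 2 * logPoly (v * b) - 2 * (v ^ 2 * logPoly v) -
      (15 / (4 * π) * v ^ 7 + 3 / π ^ 2 * v ^ 8 + 35 / (12 * π ^ 3) * v ^ 9) with hP
  have hkey : r₁ + r₂ - 2 * r₀ - logMain α v l =
      π * v * (a + b - 2 - (3 / 4 * v ^ 4 + 35 / 64 * v ^ 8)) -
      Real.log 8 * v ^ 2 * (a ^ 2 + b ^ 2 - 2 - 2 * v ^ 4) -
      (1 + α) * l * v ^ 2 * (a ^ 2 + b ^ 2 - 2 - 2 * v ^ 4) -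
      (1 + α) * v ^ 2 * (Real.log (1 + v ^ 2) * a ^ 2 + Real.log (1 - v ^ 2) * b ^ 2 +
        3 * v ^ 4) - P + A + B - 2 * C := by
    rw [logMain, hmain, hA, hB, hC, hP]
    ring
  rw [hkey]
  have e2 : 21 / 10 * v ^ 2 * (160 * v ^ 8) = 336 * v ^ 10 := by ring
  have e3 : (1 + α) * v ^ 2 * (8 * v ^ 8) = 8 * ((1 + α) * v ^ 10) := by ring
  have e3' : (1 + α) * l * v ^ 2 * (160 * v ^ 8) = 160 * ((1 + α) * l * v ^ 10) := by ring
  rw [e2] at t2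
  rw [e3] at t3
  rw [e3'] at t3''
  have m1 : v ^ 10 ≤ (1 + α) * v ^ 10 := le_mul_of_one_le_left hv10 (by linarith)
  rw [abs_le] at t1 t2 t3 hr₁ hr₂ hr₀ hlp
  constructor
  · linarith [t1.1, t2.2, t3.2, t3', t3'', hr₁.1, hr₂.1, hr₀.2, hlp.2]
  · linarith [t1.2, t2.1, t3.1, t3', t3'', hr₁.2, hr₂.2, hr₀.1, hlp.1]

lemma logMain_bounds {α v l : ℝ} (hα : 0 ≤ α) (hv0 : 0 ≤ v) (hv : v ≤ 1 / 74) (hl : 2 ≤ l)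
    (hlv : l * v ≤ 2) :
    |logMain α v l| ≤ 12 * (1 + α) * v ^ 5 ∧ logMain α v l ≤ 1 / 2 - (1 + α) * v ^ 6 := by
  obtain ⟨h8, h8'⟩ := log_eight_bounds
  have hp3 := Real.pi_gt_three
  have hp4 := Real.pi_lt_d2
  have c7 : 15 / (4 * π) ≤ 5 / 4 := by
    rw [div_le_div_iff₀ (by positivity) (by norm_num)]
    linarith
  have c8 : 3 / π ^ 2 ≤ 1 / 3 := by
    rw [div_le_div_iff₀ (by positivity) (by norm_num)]
    nlinarith
  have hc9 : 35 * (-16 + 3 * π ^ 4) / (192 * π ^ 3) = 35 * π / 64 - 35 / (12 * π ^ 3) := by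
    field_simp
    ring
  have c9 : 0 ≤ 35 / (12 * π ^ 3) := by positivity
  have c9' : 35 / (12 * π ^ 3) ≤ 1 := by
    rw [div_le_one (by positivity)]
    nlinarith [pow_le_pow_left₀ (by norm_num) hp3.le 3]
  have hv5 : 0 ≤ v ^ 5 := by positivity
  have hv6 : v ^ 6 ≤ 1 / 74 * v ^ 5 := by
    rw [show v ^ 6 = v * v ^ 5 by ring]
    gcongr
  have hv6' : 0 ≤ v ^ 6 := by positivity
  have hv7 : v ^ 7 ≤ 1 / 74 * v ^ 6 := by
    rw [show v ^ 7 = v * v ^ 6 by ring]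
    gcongr
  have hv8 : v ^ 8 ≤ 1 / 74 * v ^ 7 := by
    rw [show v ^ 8 = v * v ^ 7 by ring]
    gcongr
  have hv9 : v ^ 9 ≤ 1 / 74 * v ^ 8 := by
    rw [show v ^ 9 = v * v ^ 8 by ring]
    gcongr
  have hv9' : 0 ≤ v ^ 9 := by positivity
  have hs : v ^ 5 ≤ (1 / 74) ^ 5 := by gcongr
  have d5 : 3 * π / 4 * v ^ 5 ≤ 12 / 5 * v ^ 5 :=
    mul_le_mul_of_nonneg_right (by linarith) hv5
  have d5' : 0 ≤ 3 * π / 4 * v ^ 5 := by positivity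
  have d6 : Real.log 8 * v ^ 6 ≤ 21 / 10 * v ^ 6 := by gcongr
  have d6' : 0 ≤ Real.log 8 * v ^ 6 := by positivity
  have d7 : 15 / (4 * π) * v ^ 7 ≤ 5 / 4 * v ^ 7 := by gcongr
  have d7' : 0 ≤ 15 / (4 * π) * v ^ 7 := by positivity
  have d8 : 3 / π ^ 2 * v ^ 8 ≤ 1 / 3 * v ^ 8 := by gcongr
  have d8' : 0 ≤ 3 / π ^ 2 * v ^ 8 := by positivity
  have d9 : 35 * (-16 + 3 * π ^ 4) / (192 * π ^ 3) * v ^ 9 ≤ 2 * v ^ 9 := by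
    gcongr
    rw [hc9]
    linarith
  have d9' : 0 ≤ 35 * (-16 + 3 * π ^ 4) / (192 * π ^ 3) * v ^ 9 := by
    refine mul_nonneg ?_ hv9'
    rw [hc9]
    linarith
  have hx : (1 + α) * (2 * l - 3) * v ^ 6 ≤ 4 * (1 + α) * v ^ 5 := by
    have : (2 * l - 3) * v ≤ 4 := by linarith
    calc (1 + α) * (2 * l - 3) * v ^ 6 = (1 + α) * v ^ 5 * ((2 * l - 3) * v) := by ring
      _ ≤ (1 + α) * v ^ 5 * 4 := by gcongr
      _ = 4 * (1 + α) * v ^ 5 := by ring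
  have hx' : (1 + α) * v ^ 6 ≤ (1 + α) * (2 * l - 3) * v ^ 6 := by
    refine mul_le_mul_of_nonneg_right ?_ hv6'
    exact le_mul_of_one_le_right (by linarith) (by linarith)
  have hα6 : 0 ≤ (1 + α) * v ^ 6 := by positivity
  have hα5 : v ^ 5 ≤ (1 + α) * v ^ 5 := le_mul_of_one_le_left hv5 (by linarith)
  rw [logMain, abs_le]
  refine ⟨⟨?_, ?_⟩, ?_⟩ <;> linarith

lemma exp_le_quadratic {x : ℝ} (hx : x ≤ 1) : Real.exp x ≤ 1 + x + x ^ 2 := by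
  rcases le_or_gt (-1) x with h | h
  · have := (abs_le.1 (Real.abs_exp_sub_one_sub_id_le (abs_le.2 ⟨h, hx⟩))).2
    linarith
  · have : Real.exp x ≤ 1 := Real.exp_le_one_iff.2 (by linarith)
    nlinarith

lemma exp_bounds_of_logMain {α v l x : ℝ} (hα : 0 ≤ α) (hv0 : 0 ≤ v) (hv : v ≤ 1 / 74)
    (hl : 2 ≤ l) (hlv : l * v ≤ 2)
    (hx : -(2000 * (1 + α) * (1 + l) * v ^ 10) ≤ x - logMain α v l)
    (hx' : x - logMain α v l ≤ 2000 * (1 + α) * v ^ 10) :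
    1 + logMain α v l - 2000 * (1 + α) * (1 + l) * v ^ 10 ≤ Real.exp x ∧
      Real.exp x ≤ 1 + logMain α v l + (2000 * (1 + α) + 169 * (1 + α) ^ 2) * v ^ 10 := by
  obtain ⟨hm, hm'⟩ := logMain_bounds hα hv0 hv hl hlv
  have hv4 : v ^ 4 ≤ (1 / 74) ^ 4 := by gcongr
  have hup : 2000 * (1 + α) * v ^ 10 ≤ (1 + α) * v ^ 6 := by
    calc 2000 * (1 + α) * v ^ 10 = (1 + α) * v ^ 6 * (2000 * v ^ 4) := by ring
      _ ≤ (1 + α) * v ^ 6 * 1 := by gcongr; linarith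
      _ = _ := mul_one _
  have hup' : (1 + α) * v ^ 6 ≤ (1 + α) * v ^ 5 := by
    refine mul_le_mul_of_nonneg_left ?_ (by linarith)
    exact pow_le_pow_of_le_one hv0 (by linarith) (by norm_num)
  have hlow : 2000 * (1 + α) * (1 + l) * v ^ 10 ≤ (1 + α) * v ^ 5 := by
    calc 2000 * (1 + α) * (1 + l) * v ^ 10
        = (1 + α) * v ^ 5 * (2000 * ((v + l * v) * v ^ 4)) := by ring
      _ ≤ (1 + α) * v ^ 5 * (2000 * (3 * (1 / 74) ^ 4)) := by gcongr; linarith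
      _ ≤ (1 + α) * v ^ 5 * 1 := by gcongr; norm_num
      _ = _ := mul_one _
  have hx1 : x ≤ 1 := by linarith
  have habs : |x| ≤ 13 * (1 + α) * v ^ 5 := by
    rw [abs_le] at hm ⊢
    constructor <;> linarith [hm.1, hm.2]
  have hsq : x ^ 2 ≤ 169 * (1 + α) ^ 2 * v ^ 10 := by
    calc x ^ 2 = |x| ^ 2 := (sq_abs x).symm
      _ ≤ (13 * (1 + α) * v ^ 5) ^ 2 := by gcongr
      _ = _ := by ring
  constructor
  · linarith [Real.add_one_le_exp x]
  · linarith [exp_le_quadratic hx1]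

lemma rpow_two_ge_of_one_add {β : ℝ} (hβ : 0 ≤ β) : 1 + β ≤ (2 : ℝ) ^ (2 * β) := by
  rw [Real.rpow_def_of_pos (by norm_num)]
  have : β ≤ Real.log 2 * (2 * β) := by nlinarith [Real.log_two_gt_d9]
  linarith [Real.add_one_le_exp (Real.log 2 * (2 * β))]

lemma log_useq_bounds {α : ℝ} {n : ℕ} (hα : 0 ≤ α) (hn : 5505 ≤ n) :
    0 < useq α n ∧
    -(2000 * (1 + α) * (1 + Real.log n) * (1 / √(n : ℝ)) ^ 10) ≤
      Real.log (useq α n) - logMain α (1 / √n) (Real.log n) ∧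
    Real.log (useq α n) - logMain α (1 / √n) (Real.log n) ≤
      2000 * (1 + α) * (1 / √(n : ℝ)) ^ 10 := by
  have hnr : (5505 : ℝ) ≤ n := by exact_mod_cast hn
  have hn0 : (0 : ℝ) < n := by linarith
  obtain ⟨p₁, h₁⟩ := rseq_pos_and_log (α := α) (k := n + 1) (by lia)
  obtain ⟨p₂, h₂⟩ := rseq_pos_and_log (α := α) (k := n - 1) (by lia)
  obtain ⟨p₀, h₀⟩ := rseq_pos_and_log (α := α) (k := n) (by lia)
  have hs : 74 ≤ √(n : ℝ) := Real.le_sqrt_of_sq_le (by linarith)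
  have hv2 : (1 / √(n : ℝ)) ^ 2 = 1 / n := by rw [div_pow, one_pow, Real.sq_sqrt hn0.le]
  have hv2' : (1 : ℝ) / n ≤ 1 / 2 := one_div_le_one_div_of_le (by norm_num) (by linarith)
  have hvp : (0 : ℝ) < 1 / n := by positivity
  have hplus : ((n + 1 : ℕ) : ℝ) = n * (1 + 1 / n) := by
    push_cast
    field_simp
  have hminus : ((n - 1 : ℕ) : ℝ) = n * (1 - 1 / n) := by
    rw [Nat.cast_sub (by lia), Nat.cast_one]
    field_simp
  rw [hplus, Real.sqrt_mul hn0.le, Real.log_mul hn0.ne' (by linarith),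
    ← one_div_mul_one_div, ← hv2] at h₁
  rw [hminus, Real.sqrt_mul hn0.le, Real.log_mul hn0.ne' (by linarith),
    ← one_div_mul_one_div, ← hv2] at h₂
  have key := second_difference_bounds hα (Real.log_nonneg (by linarith)) (by positivity)
    (by positivity) (by positivity) (one_div_le_one_div_of_le (by norm_num) hs)
    (by rw [div_pow, one_pow, Real.sq_sqrt (by linarith)]; exact one_div_mul_cancel (by linarith))
    (by rw [div_pow, one_pow, Real.sq_sqrt (by linarith)]; exact one_div_mul_cancel (by linarith))
    h₁ h₂ h₀
  have hlog : Real.log (useq α n) =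
      Real.log (rseq α (n + 1)) + Real.log (rseq α (n - 1)) - 2 * Real.log (rseq α n) := by
    rw [useq, Real.log_div (mul_pos p₂ p₁).ne' (pow_pos p₀ 2).ne', Real.log_mul p₂.ne' p₁.ne',
      Real.log_pow]
    push_cast
    ring
  rw [hlog]
  exact ⟨div_pos (mul_pos p₂ p₁) (pow_pos p₀ 2), key⟩

lemma bound_main_terms {α E : ℝ} {n : ℕ} (hn : 0 < n) :
    1 + 3 * π / (4 * (n : ℝ) ^ ((5 : ℝ) / 2))
    + (3 + 3 * α - 2 * Real.log 8 - 2 * (1 + α) * Real.log n) / (n : ℝ) ^ 3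
    - 15 / (4 * π * (n : ℝ) ^ ((7 : ℝ) / 2)) - 3 / (π ^ 2 * (n : ℝ) ^ 4)
    + 35 * (-16 + 3 * π ^ 4) / (192 * π ^ 3 * (n : ℝ) ^ ((9 : ℝ) / 2)) + E / (n : ℝ) ^ 5 =
    1 + logMain α (1 / √n) (Real.log n) + E * (1 / √(n : ℝ)) ^ 10 := by
  have hn0 : (0 : ℝ) < n := by exact_mod_cast hn
  have hs0 : 0 < √(n : ℝ) := Real.sqrt_pos.2 hn0
  have hpow (k : ℕ) : (n : ℝ) ^ ((k : ℝ) / 2) = √(n : ℝ) ^ k := by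
    rw [Real.sqrt_eq_rpow, ← Real.rpow_natCast, ← Real.rpow_mul hn0.le]
    congr 1
    ring
  have h5 := hpow 5
  have h7 := hpow 7
  have h9 := hpow 9
  push_cast at h5 h7 h9
  rw [h5, h7, h9]
  have hsq : (n : ℝ) = √(n : ℝ) ^ 2 := (Real.sq_sqrt hn0.le).symm
  rw [logMain]
  generalize Real.log n = l
  generalize √(n : ℝ) = s at *
  rw [hsq]
  field_simp
  ring

theorem stmt14 (α : ℝ) (hα : 0 ≤ α) (n : ℕ) (hn : Ntil α ≤ (n : ℝ)) :
    Lbound n α < useq α n ∧ useq α n < Ubound n α := by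
  have hnr : (5505 : ℝ) ≤ n :=
    (le_max_left _ _).trans <| (le_max_right _ _).trans <| (le_max_right _ _).trans hn
  have hn5 : 5505 ≤ n := by exact_mod_cast hnr
  have hn0 : (0 : ℝ) < n := by linarith
  have hs : 74 ≤ √(n : ℝ) := Real.le_sqrt_of_sq_le (by linarith)
  have hs0 : 0 < √(n : ℝ) := by linarith
  have hlog : Real.log n = 2 * Real.log √n := by
    rw [Real.log_sqrt hn0.le]
    ring
  have hl : 2 ≤ Real.log n := by
    have : 2 ≤ Real.log 8 := log_eight_bounds.1
    exact this.trans (Real.log_le_log (by norm_num) (by linarith))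
  have hlv : Real.log n * (1 / √n) ≤ 2 := by
    rw [mul_one_div, div_le_iff₀ hs0, hlog]
    linarith [Real.log_le_sub_one_of_pos hs0]
  obtain ⟨hpos, h₁, h₂⟩ := log_useq_bounds hα hn5
  obtain ⟨hlow, hup⟩ := exp_bounds_of_logMain hα (by positivity)
    (one_div_le_one_div_of_le (by norm_num) hs) hl hlv h₁ h₂
  rw [Real.exp_log hpos] at hlow hup
  have hv10 : 0 < (1 / √(n : ℝ)) ^ 10 := by positivity
  have hpow := rpow_two_ge_of_one_add hα
  constructor
  · refine lt_of_lt_of_le ?_ hlow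
    rw [Lbound, sub_eq_add_neg _ (_ / (n : ℝ) ^ 5), ← neg_div, bound_main_terms (by lia)]
    have h16 : 2 ^ 16 * (1 + α) ≤ (2 : ℝ) ^ (16 + 7 * α) := by
      rw [Real.rpow_add (by norm_num), show (2 : ℝ) ^ (16 : ℝ) = 2 ^ 16 by norm_num]
      gcongr
      exact hpow.trans (Real.rpow_le_rpow_of_exponent_le (by norm_num) (by linarith))
    have : 2000 * (1 + α) * (1 + Real.log n) <
        258 + (80 + (2 : ℝ) ^ (16 + 7 * α)) * Real.log n := by
      have h1 : 2 ^ 16 * (1 + α) * Real.log n ≤ (2 : ℝ) ^ (16 + 7 * α) * Real.log n := by gcongr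
      have h2 : (1 + α) * 2 ≤ (1 + α) * Real.log n := by gcongr
      linarith
    linarith [mul_lt_mul_of_pos_right this hv10]
  · refine lt_of_le_of_lt hup ?_
    rw [Ubound, bound_main_terms (by lia)]
    have h31 : 2 ^ 31 * (1 + α) ^ 2 ≤ (2 : ℝ) ^ (31 + 18 * α) := by
      rw [Real.rpow_add (by norm_num), show (2 : ℝ) ^ (31 : ℝ) = 2 ^ 31 by norm_num]
      gcongr
      calc (1 + α) ^ 2 ≤ ((2 : ℝ) ^ (2 * α)) ^ 2 := by gcongr
        _ = (2 : ℝ) ^ (2 * α + 2 * α) := by rw [Real.rpow_add (by norm_num), sq]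
        _ ≤ (2 : ℝ) ^ (18 * α) :=
          Real.rpow_le_rpow_of_exponent_le (by norm_num) (by linarith)
    have : 2000 * (1 + α) + 169 * (1 + α) ^ 2 <
        6 * α + 2 ^ 12 + (2 : ℝ) ^ (31 + 18 * α) + (2 + 17 * α) * Real.log n := by
      have h1 : 0 ≤ (2 + 17 * α) * Real.log n := by positivity
      nlinarith
    linarith [mul_lt_mul_of_pos_right this hv10]
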